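/- For every ε > 0 there exists a constant C(ε) > 0 such that every odd prime p has a square-free primitive root g modulo p with 1 ≤ g ≤ C(ε) · p^{1/4+ε}. -/

import Mathlib

section PolynomialMethod

open Polynomial

/-- The operator on cofactors `k` that describes differentiation of `f ^ n * k`. -/
noncomputable def powDeriv {F : Type*} [Field F] (f : F[X]) (n : ℕ) : F[X] →ₗ[F] F[X] :=
  (n : F) • LinearMap.mulLeft F (derivative f) + LinearMap.mulLeft F f ∘ₗ derivative

/-- The cofactor of `f ^ (n - s)` in the `s`-th derivative of `f ^ n * k`. -/
noncomputable def powIterDeriv {F : Type*} [Field F] (f : F[X]) (n : ℕ) : ℕ → (F[X] →ₗ[F] F[X])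
  | 0 => LinearMap.id
  | s + 1 => powDeriv f (n - s) ∘ₗ powIterDeriv f n s

lemma iterate_derivative_pow_mul {F : Type*} [Field F] (f k : F[X]) (n s : ℕ) (h : s ≤ n) :
    derivative^[s] (f ^ n * k) = f ^ (n - s) * powIterDeriv f n s k := by
  induction s with
  | zero => simp [powIterDeriv]
  | succ s ih =>
    rw [Function.iterate_succ_apply', ih (by lia)]
    obtain ⟨m, hm⟩ : ∃ m, n - s = m + 1 := ⟨n - s - 1, by lia⟩
    have hm' : n - (s + 1) = m := by lia
    simp only [powIterDeriv, powDeriv, hm, hm', derivative_mul, derivative_pow, LinearMap.comp_apply,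
      LinearMap.add_apply, LinearMap.smul_apply, LinearMap.mulLeft_apply, smul_eq_C_mul]
    simp
    ring

lemma natDegree_powIterDeriv_le {F : Type*} [Field F] (f k : F[X]) (n s M : ℕ)
    (hf : f.natDegree ≤ M) : (powIterDeriv f n s k).natDegree ≤ k.natDegree + s * M := by
  induction s with
  | zero => simp [powIterDeriv]
  | succ s ih =>
    simp only [powIterDeriv, powDeriv, LinearMap.comp_apply,
      LinearMap.add_apply, LinearMap.smul_apply, LinearMap.mulLeft_apply]
    set q := powIterDeriv f n s k
    have h1 : (derivative f).natDegree ≤ M := (natDegree_derivative_le f).trans (by lia)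
    have h2 : (derivative q).natDegree ≤ q.natDegree := (natDegree_derivative_le q).trans (by lia)
    refine (natDegree_add_le _ _).trans (max_le ?_ ?_)
    · refine (natDegree_smul_le _ _).trans (natDegree_mul_le.trans ?_)
      rw [add_mul]; lia
    · refine (natDegree_mul_le.trans ?_)
      rw [add_mul]; lia

lemma iterate_derivative_mul_of_derivative_eq_zero {F : Type*} [Field F] (q w : F[X])
    (hw : derivative w = 0) (s : ℕ) : derivative^[s] (q * w) = derivative^[s] q * w := by
  induction s with
  | zero => rfl
  | succ s ih => simp [Function.iterate_succ_apply', ih, hw]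

lemma eq_zero_of_sum_X_pow_mul_eq_zero {F ι : Type*} [Field F] [Fintype ι] (N : ι → ℕ)
    (hN : Function.Injective N) (G : ι → F[X]) (hG : ∀ i, (G i).coeff 0 ≠ 0) (a : ι → F)
    (h : ∑ i, C (a i) * (X ^ N i * G i) = 0) : a = 0 := by
  classical
  by_contra hne
  obtain ⟨i₀, hi₀⟩ : ∃ i, a i ≠ 0 := by
    by_contra! h0
    exact hne (funext h0)
  obtain ⟨i, hi, hmin⟩ := Finset.exists_min_image (Finset.univ.filter fun i => a i ≠ 0) N
    ⟨i₀, by simpa using hi₀⟩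
  have hi' : a i ≠ 0 := by simpa using hi
  have hc := congrArg (fun P => P.coeff (N i)) h
  simp only [finsetSum_coeff, coeff_C_mul, coeff_zero, coeff_X_pow_mul'] at hc
  rw [Finset.sum_eq_single i] at hc
  · simp [hi', hG i] at hc
  · intro j _ hj
    by_cases haj : a j = 0
    · simp [haj]
    · have := hmin j (by simpa using haj)
      have hne' : N j ≠ N i := fun h' => hj (hN h')
      rw [if_neg (by lia), mul_zero]
  · simp

lemma card_mul_le_natDegree_of_iterate_derivative {p : ℕ} [Fact p.Prime] (Ψ : (ZMod p)[X])
    (hΨ : Ψ ≠ 0) (l : ℕ) (hl : 1 ≤ l) (hlp : l ≤ p) (T : Finset (ZMod p))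
    (hT : ∀ x ∈ T, ∀ s < l, (derivative^[s] Ψ).eval x = 0) : l * T.card ≤ Ψ.natDegree := by
  have hp : p.Prime := Fact.out
  have hmul : ∀ x ∈ T, l ≤ Ψ.roots.count x := by
    intro x hx
    rw [count_roots]
    have := lt_rootMultiplicity_of_isRoot_iterate_derivative_of_mem_nonZeroDivisors
      (p := Ψ) (t := x) (n := l - 1) hΨ (fun m hm => hT x hx m (by lia)) ?_
    · lia
    · rw [mem_nonZeroDivisors_iff_ne_zero]
      rw [Ne, ZMod.natCast_eq_zero_iff, hp.dvd_factorial]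
      lia
  calc l * T.card = ∑ x ∈ T, l := by simp [mul_comm]
    _ ≤ ∑ x ∈ T, Ψ.roots.count x := Finset.sum_le_sum hmul
    _ ≤ Ψ.roots.card := by
      have := Multiset.sum_count_eq_card (s := T ∪ Ψ.roots.toFinset) (m := Ψ.roots)
        (fun a ha => by simp at ha ⊢; exact Or.inr ha)
      rw [← this]
      exact Finset.sum_le_sum_of_subset Finset.subset_union_left
    _ ≤ Ψ.natDegree := card_roots' _

/-- Stepanov's method: a bound for the size of a level set of `x ↦ f(x) ^ c`, when `f` has a
simple zero at `0`. -/
lemma stepanov_aux {p : ℕ} [Fact p.Prime] (c e M l J : ℕ) (hce : c * e = p - 1) (g : (ZMod p)[X])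
    (hg : g.coeff 0 ≠ 0) (hM : (X * g).natDegree ≤ M) (w : ZMod p)
    (hl : 1 ≤ l) (hlp : l ≤ p) (hpar : l * (c + l * M + J) < e * J * c)
    (T : Finset (ZMod p)) (hT : ∀ x ∈ T, ((X * g).eval x) ^ c = w) :
    l * T.card ≤ l * M + p * M + J * p := by
  classical
  have hp : p.Prime := Fact.out
  set f := X * g with hf
  let ι := Fin e × Fin J × Fin c
  let L : (ι → ZMod p) →ₗ[ZMod p] (Fin l × Fin (c + l * M + J) → ZMod p) :=
    LinearMap.pi fun sm => ∑ i : ι, LinearMap.smulRight (LinearMap.proj i)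
      ((C (w ^ (i.1 : ℕ)) * X ^ (i.2.1 : ℕ) *
        powIterDeriv f (l + i.1 * c) sm.1 (X ^ (i.2.2 : ℕ))).coeff sm.2)
  have hker : LinearMap.ker L ≠ ⊥ := by
    apply LinearMap.ker_ne_bot_of_finrank_lt
    simp only [Module.finrank_fintype_fun_eq_card, ι, Fintype.card_prod, Fintype.card_fin]
    rw [← mul_assoc]; exact hpar
  obtain ⟨a, ha, ha0⟩ := (Submodule.ne_bot_iff _).1 hker
  have hcond : ∀ s < l, ∑ i : ι, C (a i) * (C (w ^ (i.1 : ℕ)) * X ^ (i.2.1 : ℕ) *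
      powIterDeriv f (l + i.1 * c) s (X ^ (i.2.2 : ℕ))) = 0 := by
    intro s hs
    ext m
    rw [coeff_zero]
    by_cases hm : m < c + l * M + J
    · have h1 := congrFun (LinearMap.mem_ker.1 ha) (⟨s, hs⟩, ⟨m, hm⟩)
      simpa [L, finsetSum_coeff, mul_assoc] using h1
    · rw [finsetSum_coeff]
      refine Finset.sum_eq_zero fun i _ => ?_
      rw [coeff_C_mul, coeff_eq_zero_of_natDegree_lt, mul_zero]
      have h1 := natDegree_powIterDeriv_le f (X ^ (i.2.2 : ℕ)) (l + i.1 * c) s M hM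
      rw [natDegree_X_pow] at h1
      have h2 : (C (w ^ (i.1 : ℕ)) * X ^ (i.2.1 : ℕ) : (ZMod p)[X]).natDegree ≤ i.2.1 :=
        natDegree_C_mul_X_pow_le _ _
      have h3 : s * M ≤ l * M := Nat.mul_le_mul_right _ hs.le
      have := i.2.1.2
      have := i.2.2.2
      refine natDegree_mul_le.trans_lt ?_
      lia
  have hXp : ∀ j : ℕ, derivative ((X : (ZMod p)[X]) ^ (j * p)) = 0 := by
    intro j
    rw [derivative_X_pow]
    simp
  set Ψ : (ZMod p)[X] := ∑ i : ι, C (a i) *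
    ((f ^ (l + i.1 * c) * X ^ (i.2.2 : ℕ)) * X ^ ((i.2.1 : ℕ) * p)) with hΨ
  have hev : ∀ x ∈ T, ∀ s < l, (derivative^[s] Ψ).eval x = 0 := by
    intro x hx s hs
    have h1 : (derivative^[s] Ψ).eval x = (f.eval x) ^ (l - s) *
        (∑ i : ι, C (a i) * (C (w ^ (i.1 : ℕ)) * X ^ (i.2.1 : ℕ) *
          powIterDeriv f (l + i.1 * c) s (X ^ (i.2.2 : ℕ)))).eval x := by
      rw [hΨ, iterate_derivative_sum, eval_finsetSum, eval_finsetSum, Finset.mul_sum]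
      refine Finset.sum_congr rfl fun i _ => ?_
      rw [iterate_derivative_C_mul, iterate_derivative_mul_of_derivative_eq_zero _ _ (hXp _),
        iterate_derivative_pow_mul _ _ _ _ (hs.le.trans (Nat.le_add_right _ _))]
      have h2 : l + i.1 * c - s = (l - s) + c * i.1 := by
        rw [mul_comm c]; exact Nat.sub_add_comm hs.le
      simp only [eval_mul, eval_C, eval_pow, eval_X]
      rw [h2, pow_add, pow_mul, hT x hx, mul_comm (i.2.1 : ℕ) p, pow_mul, ZMod.pow_card]
      ring
    rw [h1, hcond s hs]; simp
  have hf0 : f ≠ 0 := by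
    rw [hf]
    refine mul_ne_zero X_ne_zero ?_
    rintro rfl
    simp at hg
  have hΨ0 : Ψ ≠ 0 := by
    intro h0
    apply ha0
    refine eq_zero_of_sum_X_pow_mul_eq_zero (fun i : ι => l + i.1 * c + i.2.2 + i.2.1 * p) ?_
      (fun i : ι => g ^ (l + i.1 * c)) ?_ a ?_
    · rintro ⟨i, j, t⟩ ⟨i', j', t'⟩ h
      simp only at h
      have key : ∀ (i : Fin e) (t : Fin c), (i : ℕ) * c + t < p := by
        intro i t
        have h1 := i.2
        have h2 := t.2
        have h3 : ((i : ℕ) + 1) * c ≤ e * c := Nat.mul_le_mul_right _ h1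
        rw [mul_comm e c, add_mul, hce] at h3
        lia
      have k1 := key i t
      have k2 := key i' t'
      have hh : (i * c + t : ℕ) + p * j = (i' * c + t') + p * j' := by
        rw [mul_comm p, mul_comm p]; lia
      have hmod := congrArg (· % p) hh
      simp only [Nat.add_mul_mod_self_left, Nat.mod_eq_of_lt k1, Nat.mod_eq_of_lt k2] at hmod
      have hj : (j : ℕ) = j' := by
        have : p * (j : ℕ) = p * j' := by lia
        exact Nat.eq_of_mul_eq_mul_left hp.pos this
      have ht : (t : ℕ) = t' := by
        have := congrArg (· % c) hmod
        simpa [Nat.mul_add_mod_of_lt, Nat.add_mod, Nat.mod_eq_of_lt t.2, Nat.mod_eq_of_lt t'.2] using this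
      have hi : (i : ℕ) = i' := by
        rw [ht] at hmod
        exact Nat.eq_of_mul_eq_mul_right (t.pos) (by lia)
      exact Prod.ext (Fin.ext hi) (Prod.ext (Fin.ext hj) (Fin.ext ht))
    · intro i
      rw [coeff_zero_eq_eval_zero] at hg ⊢
      rw [eval_pow]
      exact pow_ne_zero _ hg
    · rw [← h0, hΨ]
      refine Finset.sum_congr rfl fun i _ => ?_
      rw [hf]
      ring
  refine (card_mul_le_natDegree_of_iterate_derivative Ψ hΨ0 l hl hlp T hev).trans ?_
  refine natDegree_sum_le_of_forall_le _ _ fun i _ => ?_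
  refine (natDegree_C_mul_le _ _).trans (natDegree_mul_le.trans ?_)
  rw [natDegree_X_pow]
  have h1 : (f ^ (l + i.1 * c) * X ^ (i.2.2 : ℕ)).natDegree ≤ (l + i.1 * c) * M + i.2.2 := by
    refine natDegree_mul_le.trans ?_
    rw [natDegree_X_pow]
    have := natDegree_pow_le (p := f) (n := l + i.1 * c)
    have := Nat.mul_le_mul_left (l + i.1 * c) hM
    lia
  have h2 : (i.1 : ℕ) * c ≤ p - 1 := by
    rw [← hce, mul_comm c]; exact Nat.mul_le_mul_right _ i.1.2.le
  have h3 : (i.1 : ℕ) * c * M ≤ p * M := Nat.mul_le_mul_right _ (h2.trans (by lia))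
  have h4 : ((i.2.1 : ℕ) + 1) * p ≤ J * p := Nat.mul_le_mul_right _ i.2.1.2
  have h5 : (i.2.2 : ℕ) < c := i.2.2.2
  have h6 : c ≤ p - 1 := by
    rw [← hce]; exact Nat.le_mul_of_pos_right _ i.1.pos
  rw [add_mul] at h1 h4
  lia

/-- The level sets of `x ↦ f(x) ^ c` are not much larger than expected, when `f` has a
simple zero. -/
lemma card_levelSet_le {p : ℕ} [Fact p.Prime] (hp16 : 16 ≤ p) (c e M : ℕ) (hce : c * e = p - 1)
    (f g : (ZMod p)[X]) (b : ZMod p) (hfg : f = (X - C b) * g) (hg : g.eval b ≠ 0)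
    (hM : f.natDegree ≤ M) (w : ZMod p) (T : Finset (ZMod p)) (hT : ∀ x ∈ T, (f.eval x) ^ c = w) :
    (T.card : ℝ) ≤ p / e + 13 * M * √p := by
  classical
  have he : 0 < e := Nat.pos_of_ne_zero (by rintro rfl; simp at hce; lia)
  set l := Nat.sqrt p with hl
  set J := l / e + 1 + 2 * (M + 1) with hJ
  have hl1 : l * l ≤ p := Nat.sqrt_le p
  have hl2 : p < (l + 1) * (l + 1) := Nat.lt_succ_sqrt p
  have hl4 : 4 ≤ l := by rw [hl, Nat.le_sqrt]; lia
  have hlp : l * 4 ≤ p := (Nat.mul_le_mul_left _ hl4).trans hl1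
  have hpar : l * (c + l * M + J) < e * J * c := by
    have h1 : l < e * (l / e + 1) := Nat.lt_mul_div_succ l he
    have h2 : e * J * c = e * (l / e + 1) * c + 2 * (M + 1) * (c * e) := by rw [hJ]; ring
    have h3 : l * c ≤ e * (l / e + 1) * c := Nat.mul_le_mul_right _ h1.le
    have h4 : J ≤ l + 1 + 2 * (M + 1) := by
      have := Nat.div_le_self l e
      lia
    have h5 : l * J ≤ l * l + l + 2 * (l * (M + 1)) := by
      calc l * J ≤ l * (l + 1 + 2 * (M + 1)) := Nat.mul_le_mul_left _ h4
        _ = _ := by ring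
    have h6 : l * (l * M) ≤ p * M := by
      rw [← mul_assoc]; exact Nat.mul_le_mul_right _ hl1
    have h7 : l * (M + 1) * 4 ≤ p * (M + 1) := by
      calc l * (M + 1) * 4 = l * 4 * (M + 1) := by ring
        _ ≤ _ := Nat.mul_le_mul_right _ hlp
    have h8 : 2 * (M + 1) * (c * e) + 2 * (M + 1) = 2 * (p * (M + 1)) := by
      rw [hce]
      obtain ⟨q, rfl⟩ : ∃ q, p = q + 1 := ⟨p - 1, by lia⟩
      simp; ring
    have h9 : 16 * (M + 1) ≤ p * (M + 1) := Nat.mul_le_mul_right _ hp16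
    rw [h2, mul_add, mul_add]
    rw [mul_add] at h7 h9 h5 h8
    lia
  have hfg' : f.comp (X + C b) = X * g.comp (X + C b) := by rw [hfg]; simp
  have key := stepanov_aux c e M l J hce (g.comp (X + C b))
    (by rw [coeff_zero_eq_eval_zero]; simpa using hg) (by
      rw [← hfg', natDegree_comp, natDegree_X_add_C, mul_one]; exact hM) w (by lia) (by lia) hpar
    (T.map (Equiv.subRight b).toEmbedding) (by
      intro x hx
      rw [Finset.mem_map] at hx
      obtain ⟨y, hy, rfl⟩ := hx
      rw [← hfg']
      simpa using hT y hy)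
  rw [Finset.card_map] at key
  have hM1 : 1 ≤ M := by
    refine le_trans ?_ hM
    have hg0 : g ≠ 0 := by rintro rfl; simp at hg
    rw [hfg, natDegree_mul (X_sub_C_ne_zero b) hg0, natDegree_X_sub_C]; lia
  have hs0 : 0 ≤ √(p : ℝ) := Real.sqrt_nonneg _
  have hs2 : √(p : ℝ) * √p = p := Real.mul_self_sqrt (by positivity)
  have hs1 : √(p : ℝ) ≤ 2 * l := by
    rw [Real.sqrt_le_left (by positivity)]
    have : (p : ℝ) ≤ (l + 1) * (l + 1) := by exact_mod_cast hl2.le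
    have : (4 : ℝ) ≤ l := by exact_mod_cast hl4
    nlinarith
  have hs3 : (1 : ℝ) ≤ √p := by
    rw [Real.one_le_sqrt]; exact_mod_cast (by lia : 1 ≤ p)
  have hkey : (l : ℝ) * T.card ≤ l * M + p * M + J * p := by exact_mod_cast key
  have hJr : (J : ℝ) ≤ l / e + 1 + 2 * (M + 1) := by
    rw [hJ]; push_cast
    have := Nat.cast_div_le (α := ℝ) (m := l) (n := e)
    linarith
  have hl0 : (0 : ℝ) < l := by exact_mod_cast (by lia : 0 < l)
  have hMr : (1 : ℝ) ≤ M := by exact_mod_cast hM1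
  refine le_of_mul_le_mul_left ?_ hl0
  have hp0 : (0 : ℝ) ≤ p := by positivity
  calc (l : ℝ) * T.card ≤ l * M + p * M + J * p := hkey
    _ ≤ l * M + p * M + (l / e + 1 + 2 * (M + 1)) * p := by gcongr
    _ = l * (p / e) + l * M + (3 * M + 3) * p := by ring
    _ ≤ l * (p / e) + l * M * √p + (6 * M) * (√p * (2 * l)) := by
      have h1 : (p : ℝ) ≤ √p * (2 * l) := by
        calc (p : ℝ) = √p * √p := hs2.symm
          _ ≤ _ := by gcongr
      have h2 : (l : ℝ) * M ≤ l * M * √p := le_mul_of_one_le_right (by positivity) hs3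
      have h3 : (3 * M + 3 : ℝ) * p ≤ (6 * M) * (√p * (2 * l)) := by
        apply mul_le_mul _ h1 hp0 (by positivity)
        linarith
      linarith
    _ = _ := by ring

lemma card_units_pow_eq_one {p : ℕ} [Fact p.Prime] (c e : ℕ) (hce : c * e = p - 1) :
    (Finset.univ.filter fun u : (ZMod p)ˣ => u ^ c = 1).card = c := by
  have h := IsCyclic.card_powMonoidHom_ker (G := (ZMod p)ˣ) c
  rw [Nat.card_eq_fintype_card (α := (ZMod p)ˣ), ZMod.card_units, ← hce,
    Nat.gcd_eq_right (Nat.dvd_mul_right _ _)] at h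
  refine Eq.trans ?_ h
  rw [Nat.card_eq_fintype_card, ← Fintype.card_coe]
  exact Fintype.card_congr (Equiv.subtypeEquivRight fun u => by simp)

lemma exists_pow_of_pow_eq_one {p : ℕ} [Fact p.Prime] (c e : ℕ) (hce : c * e = p - 1)
    (u : (ZMod p)ˣ) (hu : u ^ c = 1) : ∃ v : (ZMod p)ˣ, v ^ e = u := by
  have hp : p.Prime := Fact.out
  have hc : 0 < c := Nat.pos_of_ne_zero (by
    rintro rfl
    have := hp.two_le
    simp at hce; lia)
  obtain ⟨g, hg⟩ := IsCyclic.exists_generator (α := (ZMod p)ˣ)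
  obtain ⟨a, rfl⟩ := (Submonoid.mem_powers_iff _ _).1 (mem_powers_iff_mem_zpowers.2 (hg u))
  have ho : orderOf g = p - 1 := by
    rw [orderOf_eq_card_of_forall_mem_zpowers hg, Nat.card_eq_fintype_card, ZMod.card_units]
  rw [← pow_mul, ← orderOf_dvd_iff_pow_eq_one, ho, ← hce, mul_comm a] at hu
  obtain ⟨t, rfl⟩ := Nat.dvd_of_mul_dvd_mul_left hc hu
  exact ⟨g ^ t, by rw [← pow_mul, mul_comm]⟩

lemma mulChar_eq_one_of_pow_eq_one {p : ℕ} [Fact p.Prime] (c e : ℕ) (hce : c * e = p - 1)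
    (χ : MulChar (ZMod p) ℂ) (hχ : χ ^ e = 1) (u : (ZMod p)ˣ) (hu : u ^ c = 1) :
    χ (u : ZMod p) = 1 := by
  obtain ⟨v, rfl⟩ := exists_pow_of_pow_eq_one c e hce u hu
  rw [Units.val_pow_eq_pow_val, map_pow, ← MulChar.pow_apply_coe, hχ, MulChar.one_apply_coe]

lemma norm_mulChar_unit {p : ℕ} [Fact p.Prime] (χ : MulChar (ZMod p) ℂ) (u : (ZMod p)ˣ) :
    ‖χ (u : ZMod p)‖ = 1 := by
  have h : χ (u : ZMod p) ^ (p - 1) = 1 := by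
    rw [← map_pow, ← Units.val_pow_eq_pow_val, ZMod.units_pow_card_sub_one_eq_one]; simp
  have hp : p.Prime := Fact.out
  exact Complex.norm_eq_one_of_pow_eq_one h (by have := hp.two_le; lia)

lemma norm_mulChar_le_one {p : ℕ} [Fact p.Prime] (χ : MulChar (ZMod p) ℂ) (x : ZMod p) :
    ‖χ x‖ ≤ 1 := by
  by_cases hx : IsUnit x
  · obtain ⟨u, rfl⟩ := hx
    exact (norm_mulChar_unit χ u).le
  · rw [MulChar.map_nonunit _ hx]; simp

/-- A weak form of Weil's bound for character sums. -/
lemma norm_sum_mulChar_eval_le {p : ℕ} [Fact p.Prime] (hp16 : 16 ≤ p) (c e M : ℕ)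
    (hce : c * e = p - 1) (f g : (ZMod p)[X]) (b : ZMod p) (hfg : f = (X - C b) * g)
    (hg : g.eval b ≠ 0) (hM : f.natDegree ≤ M) (χ : MulChar (ZMod p) ℂ) (hχ1 : χ ≠ 1)
    (hχ : χ ^ e = 1) : ‖∑ x, χ (f.eval x)‖ ≤ 14 * e * M * √p := by
  classical
  have he : 0 < e := Nat.pos_of_ne_zero (by rintro rfl; simp at hce; lia)
  have hc : 0 < c := Nat.pos_of_ne_zero (by rintro rfl; simp at hce; lia)
  have hf0 : f ≠ 0 := by
    rw [hfg]
    refine mul_ne_zero (X_sub_C_ne_zero b) ?_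
    rintro rfl
    simp at hg
  set S := ∑ x, χ (f.eval x) with hS
  set N : (ZMod p)ˣ → Finset (ZMod p) := fun y =>
    Finset.univ.filter fun x => (f.eval x) ^ c = (y : ZMod p) ^ c with hN
  set Bd : ℝ := p / e + 13 * M * √p with hBd
  have hNle : ∀ y, ((N y).card : ℝ) ≤ Bd := fun y =>
    card_levelSet_le hp16 c e M hce f g b hfg hg hM _ _ (fun x hx => (Finset.mem_filter.1 hx).2)
  have hsum0 : ∑ y : (ZMod p)ˣ, χ (y : ZMod p) = 0 := by
    rw [← MulChar.sum_eq_zero_of_ne_one hχ1]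
    refine Fintype.sum_of_injective _ Units.val_injective _ _ (fun x hx => ?_) (fun _ => rfl)
    exact MulChar.map_nonunit _ fun ⟨u, hu⟩ => hx ⟨u, hu⟩
  have hfib : ∀ v : (ZMod p)ˣ, (Finset.univ.filter fun y : (ZMod p)ˣ =>
      (v : ZMod p) ^ c = (y : ZMod p) ^ c).card = c := by
    intro v
    refine Eq.trans ?_ (card_units_pow_eq_one c e hce)
    refine Finset.card_bij (fun y _ => y * v⁻¹) ?_ ?_ ?_
    · intro y hy
      have hy' : (v : ZMod p) ^ c = (y : ZMod p) ^ c := by simpa using hy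
      have : v ^ c = y ^ c := Units.ext (by simpa using hy')
      simp [mul_pow, ← this]
    · intro y _ y' _ h
      exact mul_right_cancel h
    · intro u hu
      have hu' : u ^ c = 1 := by simpa using hu
      refine ⟨u * v, ?_, by simp⟩
      rw [Finset.mem_filter]
      refine ⟨Finset.mem_univ _, ?_⟩
      rw [← Units.val_pow_eq_pow_val, ← Units.val_pow_eq_pow_val, mul_pow, hu', one_mul]
  have hχv : ∀ (v y : (ZMod p)ˣ), (v : ZMod p) ^ c = (y : ZMod p) ^ c →
      χ (y : ZMod p) = χ (v : ZMod p) := by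
    intro v y h
    have h' : v ^ c = y ^ c := Units.ext (by simpa using h)
    have h1 := mulChar_eq_one_of_pow_eq_one c e hce χ hχ (y * v⁻¹)
      (by rw [mul_pow, ← h', ← mul_pow, mul_inv_cancel, one_pow])
    have : (y : ZMod p) = ((y * v⁻¹ : (ZMod p)ˣ) : ZMod p) * v := by
      rw [← Units.val_mul, inv_mul_cancel_right]
    rw [this, map_mul, h1, one_mul]
  have hcS : (c : ℂ) * S = ∑ y : (ZMod p)ˣ, χ (y : ZMod p) * (N y).card := by
    rw [hS, Finset.mul_sum]
    simp only [hN, Finset.card_filter, Nat.cast_sum, Finset.mul_sum]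
    rw [Finset.sum_comm]
    refine Finset.sum_congr rfl fun x _ => ?_
    by_cases hx : IsUnit (f.eval x)
    · obtain ⟨v, hv⟩ := hx
      rw [← hv]
      have : ∀ y : (ZMod p)ˣ, χ (y : ZMod p) *
          ((if (v : ZMod p) ^ c = (y : ZMod p) ^ c then 1 else 0 : ℕ) : ℂ) =
          χ (v : ZMod p) * (if (v : ZMod p) ^ c = (y : ZMod p) ^ c then 1 else 0) := by
        intro y
        split_ifs with h
        · rw [hχv v y h]; simp
        · simp
      simp only [this, ← Finset.mul_sum, Finset.sum_boole, hfib]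
      ring
    · rw [MulChar.map_nonunit _ hx, mul_zero]
      symm
      refine Finset.sum_eq_zero fun y _ => ?_
      rw [isUnit_iff_ne_zero, not_not] at hx
      rw [hx, zero_pow hc.ne', if_neg]
      · simp
      · exact (pow_ne_zero _ y.ne_zero).symm
  have hcS' : (c : ℂ) * S = ∑ y : (ZMod p)ˣ, χ (y : ZMod p) * (((N y).card - Bd : ℝ) : ℂ) := by
    rw [hcS]
    push_cast
    simp only [mul_sub, Finset.sum_sub_distrib, ← Finset.sum_mul, hsum0]
    simp
  have htot : (c : ℝ) * (p - M) ≤ ∑ y : (ZMod p)ˣ, ((N y).card : ℝ) := by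
    have h1 : ∑ y : (ZMod p)ˣ, (N y).card = ∑ x : ZMod p,
        (Finset.univ.filter fun y : (ZMod p)ˣ => (f.eval x) ^ c = (y : ZMod p) ^ c).card := by
      simp only [hN, Finset.card_filter]
      exact Finset.sum_comm
    have h2 : c * p ≤ ∑ x : ZMod p,
        (Finset.univ.filter fun y : (ZMod p)ˣ => (f.eval x) ^ c = (y : ZMod p) ^ c).card
        + c * M := by
      have h3 : (Finset.univ.filter fun x : ZMod p => f.eval x = 0).card ≤ M := by
        refine le_trans ?_ ((card_roots' f).trans hM)
        refine le_trans (Finset.card_le_card ?_) (Multiset.toFinset_card_le _)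
        intro x hx
        simpa [hf0] using hx
      have h4 : ∀ x : ZMod p, c ≤ (Finset.univ.filter fun y : (ZMod p)ˣ =>
          (f.eval x) ^ c = (y : ZMod p) ^ c).card + c * (if f.eval x = 0 then 1 else 0) := by
        intro x
        by_cases hx : f.eval x = 0
        · simp [hx]
        · obtain ⟨v, hv⟩ := isUnit_iff_ne_zero.2 hx
          rw [← hv, hfib]
          exact Nat.le_add_right _ _
      have h5 := Finset.sum_le_sum (fun x (_ : x ∈ Finset.univ) => h4 x)
      rw [Finset.sum_add_distrib, ← Finset.mul_sum, ← Finset.card_filter] at h5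
      simp only [Finset.sum_const, Finset.card_univ, ZMod.card, smul_eq_mul] at h5
      have := Nat.mul_le_mul_left c h3
      rw [mul_comm c p]
      lia
    rw [← h1] at h2
    have h2' : (c : ℝ) * p ≤ ∑ y : (ZMod p)ˣ, ((N y).card : ℝ) + c * M := by exact_mod_cast h2
    linarith
  have hnorm : (c : ℝ) * ‖S‖ ≤ (p - 1) * Bd - c * (p - M) := by
    calc (c : ℝ) * ‖S‖ = ‖(c : ℂ) * S‖ := by simp
      _ ≤ ∑ y : (ZMod p)ˣ, ‖χ (y : ZMod p) * (((N y).card - Bd : ℝ) : ℂ)‖ := by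
        rw [hcS']; exact norm_sum_le _ _
      _ = ∑ y : (ZMod p)ˣ, (Bd - (N y).card) := by
        refine Finset.sum_congr rfl fun y _ => ?_
        rw [norm_mul, norm_mulChar_unit, one_mul, Complex.norm_real, Real.norm_eq_abs,
          abs_sub_comm, abs_of_nonneg (by linarith [hNle y])]
      _ = (p - 1) * Bd - ∑ y : (ZMod p)ˣ, ((N y).card : ℝ) := by
        rw [Finset.sum_sub_distrib, Finset.sum_const, Finset.card_univ, ZMod.card_units,
          nsmul_eq_mul, Nat.cast_sub (by lia)]
        simp
      _ ≤ _ := by linarith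
  have hce' : (p - 1 : ℝ) = c * e := by
    have : ((p - 1 : ℕ) : ℝ) = c * e := by exact_mod_cast hce.symm
    rw [Nat.cast_sub (by lia)] at this
    simpa using this
  have hc0 : (0 : ℝ) < c := by exact_mod_cast hc
  have he0 : (1 : ℝ) ≤ e := by exact_mod_cast he
  have hs3 : (1 : ℝ) ≤ √p := by
    rw [Real.one_le_sqrt]; exact_mod_cast (by lia : 1 ≤ p)
  refine le_of_mul_le_mul_left ?_ hc0
  calc (c : ℝ) * ‖S‖ ≤ (p - 1) * Bd - c * (p - M) := hnorm
    _ = c * (13 * e * M * √p + M) := by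
      rw [hce', hBd]; field_simp; ring
    _ ≤ c * (14 * e * M * √p) := by
      have : (M : ℝ) ≤ e * M * √p := by
        have h1 : (1 : ℝ) ≤ e * √p := one_le_mul_of_one_le_of_one_le he0 hs3
        nlinarith [Nat.cast_nonneg (α := ℝ) M]
      gcongr
      linarith

open ComplexConjugate in
lemma conj_mulChar_eq_pow {p : ℕ} [Fact p.Prime] (e : ℕ) (he : 2 ≤ e) (χ : MulChar (ZMod p) ℂ)
    (hχ : χ ^ e = 1) (y : ZMod p) : conj (χ y) = χ y ^ (e - 1) := by
  by_cases hy : IsUnit y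
  · obtain ⟨u, rfl⟩ := hy
    have h1 : χ (u : ZMod p) ^ e = 1 := by
      rw [← MulChar.pow_apply_coe, hχ, MulChar.one_apply_coe]
    have h2 : χ (u : ZMod p) * conj (χ (u : ZMod p)) = 1 := by
      rw [Complex.mul_conj, Complex.normSq_eq_norm_sq, norm_mulChar_unit]; simp
    have h3 : χ (u : ZMod p) * χ (u : ZMod p) ^ (e - 1) = 1 := by
      rw [← pow_succ', Nat.sub_add_cancel (by lia), h1]
    have h0 : χ (u : ZMod p) ≠ 0 := left_ne_zero_of_mul_eq_one h2
    exact mul_left_cancel₀ h0 (h2.trans h3.symm)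
  · rw [MulChar.map_nonunit _ hy, map_zero, zero_pow (by lia)]

lemma two_le_of_mulChar_pow_eq_one {p : ℕ} [Fact p.Prime] {e : ℕ} (he : 0 < e)
    {χ : MulChar (ZMod p) ℂ} (hχ1 : χ ≠ 1) (hχ : χ ^ e = 1) : 2 ≤ e := by
  by_contra h
  obtain rfl : e = 1 := by lia
  exact hχ1 (by simpa using hχ)

open ComplexConjugate in
/-- The correlation sums of a character are small when one of the shifts on the left is simple. -/
lemma norm_sum_prod_mulChar_le {p : ℕ} [Fact p.Prime] (hp16 : 16 ≤ p) (c e r : ℕ)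
    (hce : c * e = p - 1) (χ : MulChar (ZMod p) ℂ) (hχ1 : χ ≠ 1) (hχ : χ ^ e = 1)
    (u v : Fin r → ZMod p) (i : Fin r) (hu : ∀ j, j ≠ i → u j ≠ u i) (hv : ∀ j, v j ≠ u i) :
    ‖∑ x, (∏ j, χ (x + u j)) * ∏ j, conj (χ (x + v j))‖ ≤ 14 * e * (r * e : ℕ) * √p := by
  classical
  have he : 0 < e := Nat.pos_of_ne_zero (by rintro rfl; simp at hce; lia)
  have he2 := two_le_of_mulChar_pow_eq_one he hχ1 hχ
  set g : (ZMod p)[X] := (∏ j ∈ Finset.univ.erase i, (X + C (u j))) *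
    ∏ j, (X + C (v j)) ^ (e - 1) with hg
  set f : (ZMod p)[X] := (∏ j, (X + C (u j))) * ∏ j, (X + C (v j)) ^ (e - 1) with hf
  have hfx : ∀ x, χ (f.eval x) = (∏ j, χ (x + u j)) * ∏ j, conj (χ (x + v j)) := by
    intro x
    rw [hf, eval_mul, eval_prod, eval_prod, map_mul, map_prod, map_prod]
    simp [conj_mulChar_eq_pow e he2 χ hχ]
  simp only [← hfx]
  refine norm_sum_mulChar_eval_le hp16 c e (r * e) hce f g (- u i) ?_ ?_ ?_ χ hχ1 hχ
  · rw [hf, hg, ← mul_assoc, ← Finset.mul_prod_erase _ _ (Finset.mem_univ i)]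
    simp
  · rw [hg, eval_mul, eval_prod, eval_prod]
    refine mul_ne_zero (Finset.prod_ne_zero_iff.2 fun j hj => ?_)
      (Finset.prod_ne_zero_iff.2 fun j hj => ?_)
    · have := hu j (Finset.ne_of_mem_erase hj)
      simp only [eval_add, eval_X, eval_C]
      rwa [Ne, neg_add_eq_zero, eq_comm]
    · have := hv j
      simp only [eval_add, eval_X, eval_C, eval_pow]
      refine pow_ne_zero _ ?_
      rwa [Ne, neg_add_eq_zero, eq_comm]
  · refine natDegree_mul_le.trans ?_
    have h1 : (∏ j, (X + C (u j))).natDegree ≤ r := by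
      refine (natDegree_prod_le _ _).trans ?_
      simp
    have h2 : (∏ j, (X + C (v j)) ^ (e - 1)).natDegree ≤ r * (e - 1) := by
      refine (natDegree_prod_le _ _).trans ?_
      simp
    have h3 : r * e = r + r * (e - 1) := by
      obtain ⟨k, rfl⟩ : ∃ k, e = k + 1 := ⟨e - 1, by lia⟩
      simp; ring
    lia

/-- The number of functions all of whose values are attained at least twice. -/
lemma card_filter_forall_exists_ne_le {ι : Type*} [Fintype ι] [DecidableEq ι] (r B : ℕ)
    (hr : 0 < r) (hι : Fintype.card ι = 2 * r) :
    (Finset.univ.filter fun w : ι → Fin B => ∀ i, ∃ j, j ≠ i ∧ w j = w i).card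
      ≤ B ^ r * r ^ (2 * r) := by
  classical
  have hsub : Finset.univ.filter (fun w : ι → Fin B => ∀ i, ∃ j, j ≠ i ∧ w j = w i) ⊆
      Finset.univ.image fun hs : (Fin r → Fin B) × (ι → Fin r) => hs.1 ∘ hs.2 := by
    intro w hw
    have hw' : ∀ i, ∃ j, j ≠ i ∧ w j = w i := by simpa using hw
    have h1 : 2 * (Finset.univ.image w).card ≤ (Finset.univ : Finset ι).card := by
      refine Finset.mul_card_image_le_card _ _ fun b hb => ?_
      obtain ⟨i, -, rfl⟩ := Finset.mem_image.1 hb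
      obtain ⟨j, hj, hji⟩ := hw' i
      exact Finset.one_lt_card.2 ⟨j, by simpa using hji, i, by simp, hj⟩
    rw [Finset.card_univ, hι] at h1
    have h2 : Fintype.card (Set.range w) ≤ Fintype.card (Fin r) := by
      rw [← Set.toFinset_card, Set.toFinset_range, Fintype.card_fin]; lia
    obtain ⟨φ⟩ := Function.Embedding.nonempty_of_card_le h2
    have : Nonempty ι := Fintype.card_pos_iff.1 (by lia)
    rw [Finset.mem_image]
    refine ⟨(fun k => (Function.invFun φ k : Set.range w), fun i => φ ⟨w i, i, rfl⟩), by simp, ?_⟩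
    funext i
    simp [Function.leftInverse_invFun φ.injective _]
  refine (Finset.card_le_card hsub).trans (Finset.card_image_le.trans ?_)
  simp [hι]

open ComplexConjugate in
/-- Moments of short character sums. -/
lemma sum_norm_pow_le {p : ℕ} [Fact p.Prime] (hp16 : 16 ≤ p) (c e r B : ℕ) (hr : 0 < r)
    (hB : B ≤ p) (hce : c * e = p - 1) (χ : MulChar (ZMod p) ℂ) (hχ1 : χ ≠ 1) (hχ : χ ^ e = 1) :
    ∑ x : ZMod p, ‖∑ b : Fin B, χ (x + (b : ℕ))‖ ^ (2 * r) ≤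
      B ^ r * r ^ (2 * r) * p + B ^ (2 * r) * (14 * e * (r * e : ℕ) * √p) := by
  classical
  set E : ℝ := 14 * e * (r * e : ℕ) * √p with hE
  have hE0 : 0 ≤ E := by positivity
  have hinj : ∀ b b' : Fin B, ((b : ℕ) : ZMod p) = ((b' : ℕ) : ZMod p) → b = b' := by
    intro b b' h
    have := (ZMod.natCast_eq_natCast_iff' _ _ _).1 h
    rw [Nat.mod_eq_of_lt (b.2.trans_le hB), Nat.mod_eq_of_lt (b'.2.trans_le hB)] at this
    exact Fin.ext this
  let F : (Fin r ⊕ Fin r → Fin B) → ZMod p → ℂ := fun w x =>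
    (∏ j, χ (x + (w (Sum.inl j) : ℕ))) * ∏ j, conj (χ (x + (w (Sum.inr j) : ℕ)))
  have hexp : ∀ x : ZMod p, ((‖∑ b : Fin B, χ (x + (b : ℕ))‖ ^ (2 * r) : ℝ) : ℂ) = ∑ w, F w x := by
    intro x
    set z := ∑ b : Fin B, χ (x + (b : ℕ)) with hz
    have h1 : ((‖z‖ ^ (2 * r) : ℝ) : ℂ) = z ^ r * (conj z) ^ r := by
      rw [← mul_pow, Complex.mul_conj, Complex.normSq_eq_norm_sq, pow_mul]
      push_cast; ring
    rw [h1, hz, map_sum, Fintype.sum_pow, Fintype.sum_pow, Finset.sum_mul_sum,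
      ← Fintype.sum_prod_type']
    exact Fintype.sum_equiv (Equiv.sumArrowEquivProdArrow _ _ _).symm _ _ fun w => rfl
  have hFle : ∀ w, ‖∑ x, F w x‖ ≤
      (if ∀ i, ∃ j, j ≠ i ∧ w j = w i then (p : ℝ) else 0) + E := by
    intro w
    split_ifs with hw
    · have : ‖∑ x, F w x‖ ≤ p := by
        refine (norm_sum_le _ _).trans ?_
        calc ∑ x, ‖F w x‖ ≤ ∑ x : ZMod p, (1 : ℝ) := by
              refine Finset.sum_le_sum fun x _ => ?_
              rw [norm_mul, norm_prod, norm_prod]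
              refine mul_le_one₀ (Finset.prod_le_one (fun _ _ => norm_nonneg _)
                fun _ _ => norm_mulChar_le_one _ _) (by positivity)
                (Finset.prod_le_one (fun _ _ => norm_nonneg _) fun _ _ => ?_)
              rw [RCLike.norm_conj]
              exact norm_mulChar_le_one _ _
          _ = p := by simp
      linarith
    · rw [zero_add]
      push Not at hw
      obtain ⟨i, hi⟩ := hw
      rcases i with i | i
      · exact norm_sum_prod_mulChar_le hp16 c e r hce χ hχ1 hχ
          (fun j => ((w (Sum.inl j) : ℕ) : ZMod p)) (fun j => ((w (Sum.inr j) : ℕ) : ZMod p)) i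
          (fun j hj h => hi (Sum.inl j) (by simpa using hj) (hinj _ _ h))
          (fun j h => hi (Sum.inr j) (by simp) (hinj _ _ h))
      · rw [← RCLike.norm_conj, map_sum]
        have := norm_sum_prod_mulChar_le hp16 c e r hce χ hχ1 hχ
          (fun j => ((w (Sum.inr j) : ℕ) : ZMod p)) (fun j => ((w (Sum.inl j) : ℕ) : ZMod p)) i
          (fun j hj h => hi (Sum.inr j) (by simpa using hj) (hinj _ _ h))
          (fun j h => hi (Sum.inl j) (by simp) (hinj _ _ h))
        refine le_trans (le_of_eq ?_) this
        congr 1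
        refine Finset.sum_congr rfl fun x _ => ?_
        simp only [F, map_mul, map_prod, Complex.conj_conj]
        exact mul_comm _ _
  have hmain : ∑ x : ZMod p, ‖∑ b : Fin B, χ (x + (b : ℕ))‖ ^ (2 * r) ≤ ∑ w, ‖∑ x, F w x‖ := by
    have h0 : 0 ≤ ∑ x : ZMod p, ‖∑ b : Fin B, χ (x + (b : ℕ))‖ ^ (2 * r) := by positivity
    have h1 : ((∑ x : ZMod p, ‖∑ b : Fin B, χ (x + (b : ℕ))‖ ^ (2 * r) : ℝ) : ℂ) =
        ∑ w, ∑ x, F w x := by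
      rw [Complex.ofReal_sum, Finset.sum_comm]
      exact Finset.sum_congr rfl fun x _ => hexp x
    rw [← abs_of_nonneg h0, ← Real.norm_eq_abs, ← Complex.norm_real, h1]
    exact norm_sum_le _ _
  refine hmain.trans ((Finset.sum_le_sum fun w _ => hFle w).trans ?_)
  rw [Finset.sum_add_distrib, ← Finset.sum_filter, Finset.sum_const, Finset.sum_const,
    nsmul_eq_mul, nsmul_eq_mul]
  have hbad := card_filter_forall_exists_ne_le (ι := Fin r ⊕ Fin r) r B hr (by simp; lia)
  have hbad' : ((Finset.univ.filter fun w : Fin r ⊕ Fin r → Fin B =>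
      ∀ i, ∃ j, j ≠ i ∧ w j = w i).card : ℝ) ≤ B ^ r * r ^ (2 * r) := by exact_mod_cast hbad
  have hcard : ((Finset.univ : Finset (Fin r ⊕ Fin r → Fin B)).card : ℝ) = B ^ (2 * r) := by
    rw [Finset.card_univ]
    simp [two_mul]
  rw [hcard]
  gcongr

end PolynomialMethod

/-- The divisor bound `d(n) ≪ n ^ τ`. -/
lemma exists_card_divisors_le (τ : ℝ) (hτ : 0 < τ) :
    ∃ K : ℝ, 1 ≤ K ∧ ∀ n : ℕ, 1 ≤ n → (n.divisors.card : ℝ) ≤ K * (n : ℝ) ^ τ := by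
  have hlog : 0 < Real.log 2 := Real.log_pos one_lt_two
  set K : ℝ := 1 + 1 / (τ * Real.log 2) with hK
  have hK1 : 1 ≤ K := by
    have : 0 < 1 / (τ * Real.log 2) := by positivity
    linarith
  obtain ⟨P, hP⟩ := exists_nat_ge ((2 : ℝ) ^ (1 / τ))
  have hsmall : ∀ q a : ℕ, 2 ≤ q → (a + 1 : ℝ) ≤ K * (q : ℝ) ^ (τ * a) := by
    intro q a hq
    have hq' : (2 : ℝ) ≤ q := by exact_mod_cast hq
    have h1 : (2 : ℝ) ^ (τ * a) ≤ (q : ℝ) ^ (τ * a) :=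
      Real.rpow_le_rpow (by norm_num) hq' (by positivity)
    have h2 : 1 + τ * a * Real.log 2 ≤ (2 : ℝ) ^ (τ * a) := by
      rw [Real.rpow_def_of_pos (by norm_num)]
      have := Real.add_one_le_exp (Real.log 2 * (τ * a))
      linarith
    have h3 : (a + 1 : ℝ) ≤ K * (1 + τ * a * Real.log 2) := by
      have : K * (1 + τ * a * Real.log 2) =
          a + 1 + (τ * a * Real.log 2 + 1 / (τ * Real.log 2)) := by
        rw [hK]; field_simp; ring
      rw [this]
      have : 0 ≤ τ * a * Real.log 2 + 1 / (τ * Real.log 2) := by positivity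
      linarith
    exact h3.trans (mul_le_mul_of_nonneg_left (h2.trans h1) (by linarith))
  have hlarge : ∀ q a : ℕ, P ≤ q → 2 ≤ q → (a + 1 : ℝ) ≤ (q : ℝ) ^ (τ * a) := by
    intro q a hPq hq
    have hq' : (2 : ℝ) ^ (1 / τ) ≤ q := hP.trans (by exact_mod_cast hPq)
    have h1 : (2 : ℝ) ≤ (q : ℝ) ^ τ := by
      calc (2 : ℝ) = ((2 : ℝ) ^ (1 / τ)) ^ τ := by
            rw [← Real.rpow_mul (by norm_num), one_div_mul_cancel hτ.ne', Real.rpow_one]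
        _ ≤ _ := Real.rpow_le_rpow (by positivity) hq' hτ.le
    rw [Real.rpow_mul (by positivity), Real.rpow_natCast]
    have h2 : ((a + 1 : ℕ) : ℝ) ≤ ((2 ^ a : ℕ) : ℝ) := by exact_mod_cast (Nat.lt_two_pow_self : a < 2 ^ a)
    push_cast at h2
    exact h2.trans (pow_le_pow_left₀ (by norm_num) h1 a)
  refine ⟨K ^ P, one_le_pow₀ hK1, fun n hn => ?_⟩
  rw [Nat.card_divisors (by lia)]
  push_cast
  have hterm : ∀ q ∈ n.primeFactors, (n.factorization q + 1 : ℝ) ≤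
      (if q < P then K else 1) * ((q ^ n.factorization q : ℕ) : ℝ) ^ τ := by
    intro q hq
    have hq2 : 2 ≤ q := (Nat.prime_of_mem_primeFactors hq).two_le
    have : ((q ^ n.factorization q : ℕ) : ℝ) ^ τ = (q : ℝ) ^ (τ * n.factorization q) := by
      push_cast
      rw [← Real.rpow_natCast, ← Real.rpow_mul (by positivity), mul_comm]
    rw [this]
    split_ifs with h
    · exact hsmall _ _ hq2
    · rw [one_mul]; exact hlarge _ _ (by lia) hq2
  refine (Finset.prod_le_prod (fun _ _ => by positivity) hterm).trans ?_
  rw [Finset.prod_mul_distrib, Real.finsetProd_rpow _ _ (fun _ _ => by positivity), ← Nat.cast_prod]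
  have h1 : ∏ q ∈ n.primeFactors, q ^ n.factorization q = n := Nat.prod_factorization_pow_eq_self (by lia)
  rw [h1]
  refine mul_le_mul_of_nonneg_right ?_ (by positivity)
  rw [Finset.prod_ite, Finset.prod_const, Finset.prod_const_one, mul_one]
  refine pow_le_pow_right₀ hK1 ?_
  refine (Finset.card_le_card (t := Finset.range P) ?_).trans (by simp)
  intro q hq
  simpa using (Finset.mem_filter.1 hq).2

lemma norm_sum_shift_sub_le (F : ℕ → ℂ) (hF : ∀ n, ‖F n‖ ≤ 1) (N h : ℕ) :
    ‖∑ n ∈ Finset.range N, F n - ∑ n ∈ Finset.range N, F (n + h)‖ ≤ 2 * h := by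
  induction h with
  | zero => simp
  | succ h ih =>
    have h1 : ∑ n ∈ Finset.range N, F (n + (h + 1)) =
        ∑ n ∈ Finset.range N, F (n + h) + (F (N + h) - F h) := by
      have h2 := Finset.sum_range_succ (fun n => F (n + h)) N
      have h3 := Finset.sum_range_succ' (fun n => F (n + h)) N
      rw [h2, zero_add] at h3
      have h4 : ∀ n, F (n + 1 + h) = F (n + (h + 1)) := fun n => by congr 1; ring
      simp only [h4] at h3
      linear_combination -h3
    rw [h1]
    calc _ = ‖(∑ n ∈ Finset.range N, F n - ∑ n ∈ Finset.range N, F (n + h)) + (F h - F (N + h))‖ := by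
          congr 1; ring
      _ ≤ 2 * h + (1 + 1) := (norm_add_le _ _).trans (add_le_add ih
          ((norm_sub_le _ _).trans (add_le_add (hF _) (hF _))))
      _ = _ := by push_cast; ring

lemma card_filter_mul_eq_mul_le (A N p : ℕ) (hAN : A * N < p) (D : ℝ)
    (hD : ∀ m : ℕ, 1 ≤ m → m < p → (m.divisors.card : ℝ) ≤ D) :
    ((((Finset.Icc 1 A ×ˢ Finset.Icc 1 N) ×ˢ (Finset.Icc 1 A ×ˢ Finset.Icc 1 N)).filter
      fun t => t.1.2 * t.2.1 = t.2.2 * t.1.1).card : ℝ) ≤ A * N * D := by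
  classical
  have h1 : (((Finset.Icc 1 A ×ˢ Finset.Icc 1 N) ×ˢ (Finset.Icc 1 A ×ˢ Finset.Icc 1 N)).filter
      fun t => t.1.2 * t.2.1 = t.2.2 * t.1.1).card ≤
      ∑ s ∈ Finset.Icc 1 A ×ˢ Finset.Icc 1 N, (s.2 * s.1).divisors.card := by
    rw [← Finset.card_sigma]
    refine Finset.card_le_card_of_injOn (fun t => ⟨(t.1.1, t.2.2), t.2.1⟩) ?_ ?_
    · rintro ⟨⟨a, n⟩, ⟨a', n'⟩⟩ ht
      simp only [Finset.coe_filter, Finset.mem_product, Finset.mem_Icc, Set.mem_ofPred_eq] at ht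
      simp only [Finset.coe_sigma, Set.mem_sigma_iff, Finset.mem_coe, Finset.mem_product,
        Finset.mem_Icc, Nat.mem_divisors]
      refine ⟨⟨ht.1.1.1, ht.1.2.2⟩, ⟨n, by rw [← ht.2]; ring⟩, ?_⟩
      have h1 := ht.1.1.1.1
      have h2 := ht.1.2.2.1
      positivity
    · rintro ⟨⟨a, n⟩, ⟨a', n'⟩⟩ ht ⟨⟨b, m⟩, ⟨b', m'⟩⟩ hs h
      simp only [Finset.coe_filter, Finset.mem_product, Finset.mem_Icc, Set.mem_ofPred_eq] at ht hs
      simp only [Sigma.mk.injEq, Prod.mk.injEq, heq_eq_eq] at h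
      obtain ⟨⟨rfl, rfl⟩, rfl⟩ := h
      have : n = m := Nat.eq_of_mul_eq_mul_right (by lia : 0 < a') (ht.2.trans hs.2.symm)
      rw [this]
  have h2 : ∀ s ∈ Finset.Icc 1 A ×ˢ Finset.Icc 1 N, ((s.2 * s.1).divisors.card : ℝ) ≤ D := by
    intro s hs
    simp only [Finset.mem_product, Finset.mem_Icc] at hs
    refine hD _ (Nat.mul_pos (by lia) (by lia)) (lt_of_le_of_lt ?_ hAN)
    rw [mul_comm]
    exact Nat.mul_le_mul hs.1.2 hs.2.2
  calc _ ≤ ∑ s ∈ Finset.Icc 1 A ×ˢ Finset.Icc 1 N, ((s.2 * s.1).divisors.card : ℝ) := by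
        exact_mod_cast h1
    _ ≤ ∑ s ∈ Finset.Icc 1 A ×ˢ Finset.Icc 1 N, D := Finset.sum_le_sum h2
    _ = _ := by simp

/-- Hölder's inequality for sums over fractions `n / a` modulo `p`. -/
lemma sum_fractions_pow_le {p : ℕ} [Fact p.Prime] (A N r : ℕ) (hr : 0 < r) (hAN : A * N < p)
    (D : ℝ) (hD : ∀ m : ℕ, 1 ≤ m → m < p → (m.divisors.card : ℝ) ≤ D) (W : ZMod p → ℝ)
    (hW : ∀ x, 0 ≤ W x) :
    (∑ t ∈ Finset.Icc 1 A ×ˢ Finset.Icc 1 N, W ((t.2 : ZMod p) * (t.1 : ZMod p)⁻¹)) ^ (2 * r) ≤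
      (A * N : ℝ) ^ (2 * r - 1) * D * ∑ x, W x ^ (2 * r) := by
  classical
  set P := Finset.Icc 1 A ×ˢ Finset.Icc 1 N with hP
  set φ : ℕ × ℕ → ZMod p := fun t => (t.2 : ZMod p) * (t.1 : ZMod p)⁻¹ with hφ
  have hcard : (P.card : ℝ) = A * N := by simp [hP]
  obtain ⟨k, rfl⟩ : ∃ k, r = k + 1 := ⟨r - 1, by lia⟩
  have h1 : (∑ t ∈ P, W (φ t)) ^ (k + 1) ≤ (A * N : ℝ) ^ k * ∑ t ∈ P, W (φ t) ^ (k + 1) := by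
    rw [← hcard]
    exact pow_sum_le_card_mul_sum_pow (fun t _ => hW _) k
  have h2 : ∑ t ∈ P, W (φ t) ^ (k + 1) =
      ∑ x, ((P.filter fun t => φ t = x).card : ℝ) * W x ^ (k + 1) := by
    rw [← Finset.sum_fiberwise P φ]
    refine Finset.sum_congr rfl fun x _ => ?_
    rw [← nsmul_eq_mul, ← Finset.sum_const]
    refine Finset.sum_congr rfl fun t ht => ?_
    rw [(Finset.mem_filter.1 ht).2]
  have h3 : (∑ t ∈ P, W (φ t) ^ (k + 1)) ^ 2 ≤
      (∑ x, ((P.filter fun t => φ t = x).card : ℝ) ^ 2) * ∑ x, W x ^ (2 * (k + 1)) := by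
    rw [h2]
    refine (Finset.sum_mul_sq_le_sq_mul_sq _ _ _).trans (le_of_eq ?_)
    simp only [← pow_mul, mul_comm 2]
  have h4 : ∑ x, ((P.filter fun t => φ t = x).card : ℝ) ^ 2 ≤ A * N * D := by
    refine le_trans ?_ (card_filter_mul_eq_mul_le A N p hAN D hD)
    rw [← hP]
    have : ∑ x, (P.filter fun t => φ t = x).card ^ 2 =
        ((P ×ˢ P).filter fun t => φ t.1 = φ t.2).card := by
      rw [Finset.card_eq_sum_card_fiberwise (f := fun t : (ℕ × ℕ) × (ℕ × ℕ) => φ t.1)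
        (t := Finset.univ) (by simp)]
      refine Finset.sum_congr rfl fun x _ => ?_
      rw [sq, ← Finset.card_product]
      congr 1
      ext t
      simp only [Finset.mem_product, Finset.mem_filter]
      constructor
      · rintro ⟨⟨a, b⟩, c, d⟩; exact ⟨⟨⟨a, c⟩, b.trans d.symm⟩, b⟩
      · rintro ⟨⟨⟨a, b⟩, c⟩, d⟩; exact ⟨⟨a, d⟩, b, c.symm.trans d⟩
    have h5 : ((P ×ˢ P).filter fun t => φ t.1 = φ t.2) ⊆
        (P ×ˢ P).filter fun t => t.1.2 * t.2.1 = t.2.2 * t.1.1 := by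
      rintro ⟨⟨a, n⟩, ⟨b, m⟩⟩ ht
      simp only [Finset.mem_filter, Finset.mem_product, hP, Finset.mem_Icc, hφ] at ht ⊢
      refine ⟨ht.1, ?_⟩
      obtain ⟨⟨⟨⟨ha1, ha2⟩, hn1, hn2⟩, ⟨hb1, hb2⟩, hm1, hm2⟩, h⟩ := ht
      have hne : ∀ a : ℕ, 1 ≤ a → a ≤ A → (a : ZMod p) ≠ 0 := by
        intro a h1 h2 h
        rw [ZMod.natCast_eq_zero_iff] at h
        have := Nat.le_of_dvd h1 h
        have := Nat.le_mul_of_pos_right A (by lia : 0 < N)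
        lia
      have hne1 := hne a ha1 ha2
      have hne2 := hne b hb1 hb2
      have h6 : ((n * b : ℕ) : ZMod p) = ((m * a : ℕ) : ZMod p) := by
        push_cast
        field_simp at h
        linear_combination h
      rw [ZMod.natCast_eq_natCast_iff'] at h6
      have h7 : n * b ≤ A * N := by rw [mul_comm A]; exact Nat.mul_le_mul hn2 hb2
      have h8 : m * a ≤ A * N := by rw [mul_comm A]; exact Nat.mul_le_mul hm2 ha2
      rwa [Nat.mod_eq_of_lt (by lia), Nat.mod_eq_of_lt (by lia)] at h6
    have h6 := Finset.card_le_card h5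
    rw [← this] at h6
    exact_mod_cast h6
  have hM0 : 0 ≤ ∑ x, W x ^ (2 * (k + 1)) := Finset.sum_nonneg fun x _ => pow_nonneg (hW x) _
  have hT0 : 0 ≤ ∑ t ∈ P, W (φ t) := Finset.sum_nonneg fun x _ => hW _
  calc (∑ t ∈ P, W (φ t)) ^ (2 * (k + 1)) = ((∑ t ∈ P, W (φ t)) ^ (k + 1)) ^ 2 := by
        rw [← pow_mul, mul_comm]
    _ ≤ ((A * N : ℝ) ^ k * ∑ t ∈ P, W (φ t) ^ (k + 1)) ^ 2 :=
        pow_le_pow_left₀ (pow_nonneg hT0 _) h1 2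
    _ = (A * N : ℝ) ^ (2 * k) * (∑ t ∈ P, W (φ t) ^ (k + 1)) ^ 2 := by
        rw [mul_pow, ← pow_mul, mul_comm k]
    _ ≤ (A * N : ℝ) ^ (2 * k) * ((A * N * D) * ∑ x, W x ^ (2 * (k + 1))) := by
        refine mul_le_mul_of_nonneg_left (h3.trans ?_) (by positivity)
        exact mul_le_mul_of_nonneg_right h4 hM0
    _ = _ := by
        rw [show 2 * (k + 1) - 1 = 2 * k + 1 by lia, pow_succ]
        ring

/-- Burgess's amplification. -/
lemma exists_burgess_amplification {p : ℕ} [Fact p.Prime] (hp16 : 16 ≤ p) (c e r A B N : ℕ)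
    (hr : 0 < r) (hB : B ≤ p) (hAN : A * N < p) (hN : 0 < N) (hce : c * e = p - 1)
    (χ : MulChar (ZMod p) ℂ) (hχ1 : χ ≠ 1) (hχ : χ ^ e = 1) (D : ℝ) (hD0 : 0 ≤ D)
    (hD : ∀ m : ℕ, 1 ≤ m → m < p → (m.divisors.card : ℝ) ≤ D) :
    ∃ T : ℝ, 0 ≤ T ∧ A * B * ‖∑ n ∈ Finset.Icc 1 N, χ (n : ZMod p)‖ ≤ 2 * (A * B) ^ 2 + T ∧
      T ^ (2 * r) ≤ (A * N : ℝ) ^ (2 * r - 1) * D *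
        (B ^ r * r ^ (2 * r) * p + B ^ (2 * r) * (14 * e * (r * e : ℕ) * √p)) := by
  classical
  set W : ZMod p → ℝ := fun x => ‖∑ b : Fin B, χ (x + (b : ℕ))‖ with hW
  refine ⟨∑ t ∈ Finset.Icc 1 A ×ˢ Finset.Icc 1 N, W ((t.2 : ZMod p) * (t.1 : ZMod p)⁻¹),
    Finset.sum_nonneg fun _ _ => norm_nonneg _, ?_,
    (sum_fractions_pow_le A N r hr hAN D hD W fun _ => norm_nonneg _).trans ?_⟩
  · set S := ∑ n ∈ Finset.Icc 1 N, χ (n : ZMod p) with hS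
    have hSr : S = ∑ n ∈ Finset.range N, χ ((n + 1 : ℕ) : ZMod p) := by
      rw [hS, Finset.range_eq_Ico, Finset.sum_Ico_add' (fun n : ℕ => χ (n : ZMod p)) 0 N 1]
      rfl
    have hdiff : ∀ a ∈ Finset.Icc 1 A, ∀ b : Fin B,
        ‖S - ∑ n ∈ Finset.Icc 1 N, χ ((n : ZMod p) + a * (b : ℕ))‖ ≤ 2 * (A * B) := by
      intro a ha b
      have h1 := norm_sum_shift_sub_le (fun n => χ ((n + 1 : ℕ) : ZMod p))
        (fun n => norm_mulChar_le_one _ _) N (a * b)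
      have h2 : ∑ n ∈ Finset.Icc 1 N, χ ((n : ZMod p) + a * (b : ℕ)) =
          ∑ n ∈ Finset.range N, χ ((n + a * b + 1 : ℕ) : ZMod p) := by
        rw [Finset.range_eq_Ico]
        have := Finset.sum_Ico_add' (fun n : ℕ => χ ((n : ZMod p) + a * (b : ℕ))) 0 N 1
        rw [show Finset.Ico (0 + 1) (N + 1) = Finset.Icc 1 N from rfl] at this
        rw [← this]
        refine Finset.sum_congr rfl fun n _ => ?_
        congr 1; push_cast; ring
      rw [hSr, h2]
      refine h1.trans ?_
      have h3 : a * (b : ℕ) ≤ A * B := Nat.mul_le_mul (Finset.mem_Icc.1 ha).2 b.2.le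
      have h4 : ((a * (b : ℕ) : ℕ) : ℝ) ≤ A * B := by exact_mod_cast h3
      linarith
    have hfrac : ∀ t ∈ Finset.Icc 1 A ×ˢ Finset.Icc 1 N,
        ‖∑ b : Fin B, χ ((t.2 : ZMod p) + t.1 * (b : ℕ))‖ =
          W ((t.2 : ZMod p) * (t.1 : ZMod p)⁻¹) := by
      rintro ⟨a, n⟩ ht
      simp only [Finset.mem_product, Finset.mem_Icc] at ht
      have ha : (a : ZMod p) ≠ 0 := by
        intro h
        rw [ZMod.natCast_eq_zero_iff] at h
        have := Nat.le_of_dvd ht.1.1 h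
        have := Nat.le_mul_of_pos_right A hN
        lia
      have h1 : ∀ b : Fin B, χ ((n : ZMod p) + a * (b : ℕ)) =
          χ (a : ZMod p) * χ ((n : ZMod p) * (a : ZMod p)⁻¹ + (b : ℕ)) := by
        intro b
        rw [← map_mul]
        congr 1
        field_simp
      have h2 : ‖χ (a : ZMod p)‖ = 1 := norm_mulChar_unit χ (Units.mk0 _ ha)
      simp only [h1, ← Finset.mul_sum, norm_mul, h2, one_mul, hW]
    have hsum : ∑ t ∈ Finset.Icc 1 A ×ˢ Finset.Icc 1 N, ∑ b : Fin B,
        χ ((t.2 : ZMod p) + t.1 * (b : ℕ)) = ∑ a ∈ Finset.Icc 1 A, ∑ b : Fin B,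
          ∑ n ∈ Finset.Icc 1 N, χ ((n : ZMod p) + a * (b : ℕ)) := by
      rw [Finset.sum_product]
      refine Finset.sum_congr rfl fun a _ => ?_
      exact Finset.sum_comm
    have hABS : (A * B : ℂ) * S = ∑ a ∈ Finset.Icc 1 A, ∑ b : Fin B,
        (S - ∑ n ∈ Finset.Icc 1 N, χ ((n : ZMod p) + a * (b : ℕ))) +
        ∑ t ∈ Finset.Icc 1 A ×ˢ Finset.Icc 1 N, ∑ b : Fin B,
          χ ((t.2 : ZMod p) + t.1 * (b : ℕ)) := by
      rw [hsum]
      simp only [Finset.sum_sub_distrib, Finset.sum_const, Finset.card_univ, Fintype.card_fin,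
        Nat.card_Icc]
      simp
      ring
    calc A * B * ‖S‖ = ‖(A * B : ℂ) * S‖ := by simp
      _ ≤ _ := by
        rw [hABS]
        refine (norm_add_le _ _).trans (add_le_add ?_ ?_)
        · calc _ ≤ ∑ a ∈ Finset.Icc 1 A, ∑ b : Fin B, (2 * (A * B) : ℝ) :=
                (norm_sum_le _ _).trans (Finset.sum_le_sum fun a ha =>
                  (norm_sum_le _ _).trans (Finset.sum_le_sum fun b _ => hdiff a ha b))
            _ = _ := by simp; ring
        · refine (norm_sum_le _ _).trans (Finset.sum_le_sum fun t ht => ?_)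
          rw [hfrac t ht]
  · exact mul_le_mul_of_nonneg_left (sum_norm_pow_le hp16 c e r B hr hB hce χ hχ1 hχ)
      (by positivity)

lemma eventually_le_natCast_rpow (C : ℝ) {x : ℝ} (hx : 0 < x) :
    ∀ᶠ p : ℕ in Filter.atTop, C ≤ (p : ℝ) ^ x :=
  ((tendsto_rpow_atTop hx).comp tendsto_natCast_atTop_atTop).eventually_ge_atTop C

set_option maxHeartbeats 1000000 in
/-- Burgess's bound for characters of small order. -/
lemma exists_burgess_bound {κ : ℝ} (hκ : 0 < κ) (hκ8 : κ ≤ 1 / 8) :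
    ∃ η : ℝ, 0 < η ∧ η ≤ κ / 64 ∧ ∀ᶠ p : ℕ in Filter.atTop, ∀ [Fact p.Prime] (c e : ℕ),
      c * e = p - 1 → (e : ℝ) ≤ (p : ℝ) ^ η → ∀ χ : MulChar (ZMod p) ℂ, χ ≠ 1 → χ ^ e = 1 →
        ∀ N : ℕ, (p : ℝ) ^ (1 / 4 + κ) ≤ N → (N : ℝ) ≤ (p : ℝ) ^ (1 / 2 : ℝ) →
          ‖∑ n ∈ Finset.Icc 1 N, χ (n : ZMod p)‖ ≤ N * (p : ℝ) ^ (-η) := by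
  set r := ⌈1 / κ⌉₊ with hr
  have hr1 : 1 / κ ≤ r := Nat.le_ceil _
  have hr8 : (8 : ℝ) ≤ r := le_trans (by rw [le_div_iff₀ hκ]; linarith) hr1
  have hr0 : 0 < r := by
    have : (0 : ℝ) < r := by linarith
    exact_mod_cast this
  have hrκ : 1 ≤ κ * r := by rwa [div_le_iff₀' hκ] at hr1
  set η := κ / (8 * r) with hη
  have hη0 : 0 < η := by positivity
  have hη64 : η ≤ κ / 64 := by
    rw [hη]; exact div_le_div_of_nonneg_left hκ.le (by norm_num) (by linarith)
  have hrinv : 1 / (2 * (r : ℝ)) ≤ κ / 2 := by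
    rw [div_le_div_iff₀ (by positivity) (by norm_num)]; linarith
  have hηr : 4 * r * η = κ / 2 := by rw [hη]; field_simp; norm_num
  obtain ⟨K', hK'1, hK'⟩ := exists_card_divisors_le (κ / 4) (by positivity)
  set K : ℝ := (r : ℝ) ^ (2 * r) + 14 * r with hK
  have hK0 : 0 < K := by positivity
  refine ⟨η, hη0, hη64, ?_⟩
  filter_upwards [Filter.eventually_ge_atTop 16, eventually_le_natCast_rpow 3 hη0,
    eventually_le_natCast_rpow (4 * K * K') (show 0 < κ / 4 by positivity),
    eventually_le_natCast_rpow 2 (show (0 : ℝ) < 1 / 8 by norm_num)] with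
    p hp16 hp3 hpK hp2 _ c e hce he χ hχ1 hχ N hN1 hN2
  set P : ℝ := (p : ℝ) with hP
  have hP16 : (16 : ℝ) ≤ P := by rw [hP]; exact_mod_cast hp16
  have hP1 : 1 ≤ P := by linarith
  have hP0 : 0 < P := by linarith
  have mono : ∀ {x y : ℝ}, x ≤ y → P ^ x ≤ P ^ y := fun h => Real.rpow_le_rpow_of_exponent_le hP1 h
  have e1 : (1 : ℝ) ≤ e := by
    have : 0 < e := Nat.pos_of_ne_zero (by rintro rfl; simp at hce; lia)
    exact_mod_cast this
  set V := P ^ (1 / (2 * r) : ℝ) with hV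
  set B := ⌈V⌉₊ with hB
  have hV1 : 1 ≤ V := Real.one_le_rpow hP1 (by positivity)
  have hVB : V ≤ B := Nat.le_ceil _
  have hB2 : (B : ℝ) ≤ 2 * V := by
    have := Nat.ceil_lt_add_one (zero_le_one.trans hV1)
    linarith
  have hV16 : V ≤ P ^ (1 / 16 : ℝ) := mono (by linarith)
  have hB1 : (1 : ℝ) ≤ B := hV1.trans hVB
  have hB0 : (0 : ℝ) < B := by linarith
  have hVr : V ^ r = √P := by
    rw [hV, ← Real.rpow_natCast, ← Real.rpow_mul hP0.le, Real.sqrt_eq_rpow]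
    congr 1; field_simp
  have hBr : √P ≤ (B : ℝ) ^ r := by
    rw [← hVr]; exact pow_le_pow_left₀ (by linarith) hVB r
  have hNpos : (0 : ℝ) < N := lt_of_lt_of_le (by positivity) hN1
  set x := N * P ^ (-(2 * η)) / B with hx
  have hxlow : P ^ (1 / 4 + κ - 2 * η - 1 / (2 * r)) / 2 ≤ x := by
    rw [hx, div_le_div_iff₀ (by norm_num) hB0]
    calc P ^ (1 / 4 + κ - 2 * η - 1 / (2 * r)) * B ≤
        P ^ (1 / 4 + κ - 2 * η - 1 / (2 * r)) * (2 * V) :=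
          mul_le_mul_of_nonneg_left hB2 (by positivity)
      _ = P ^ (1 / 4 + κ) * P ^ (-(2 * η)) * 2 := by
        rw [hV, ← Real.rpow_add hP0, mul_left_comm, ← Real.rpow_add hP0, mul_comm]
        congr 2; ring
      _ ≤ N * P ^ (-(2 * η)) * 2 := by gcongr
  have hx1 : 1 ≤ x := by
    refine le_trans ?_ hxlow
    have : P ^ (1 / 8 : ℝ) ≤ P ^ (1 / 4 + κ - 2 * η - 1 / (2 * r)) := mono (by linarith)
    linarith
  set A := ⌊x⌋₊ with hA
  have hAx : (A : ℝ) ≤ x := Nat.floor_le (by linarith)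
  have hA1 : 1 ≤ A := Nat.le_floor (by simpa using hx1)
  have hA1' : (1 : ℝ) ≤ A := by exact_mod_cast hA1
  have hA2 : x / 2 ≤ A := by
    have := Nat.lt_floor_add_one x
    linarith
  have hAB : (A : ℝ) * B ≤ N * P ^ (-(2 * η)) := by
    rwa [hx, le_div_iff₀ hB0] at hAx
  have hsm : P ^ (-(2 * η)) < 1 := Real.rpow_lt_one_of_one_lt_of_neg (by linarith) (by linarith)
  have hAN : A * N < p := by
    have h1 : (A : ℝ) * N < P := by
      have h2 : (A : ℝ) ≤ A * B := le_mul_of_one_le_right (by positivity) hB1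
      have h3 : (A : ℝ) < N := (h2.trans hAB).trans_lt (mul_lt_of_lt_one_right hNpos hsm)
      calc (A : ℝ) * N < N * N := mul_lt_mul_of_pos_right h3 hNpos
        _ ≤ P ^ (1 / 2 : ℝ) * P ^ (1 / 2 : ℝ) := by gcongr
        _ = P := by rw [← Real.rpow_add hP0]; norm_num
    rw [hP] at h1
    exact_mod_cast h1
  have hBp : B ≤ p := by
    have h1 : (B : ℝ) ≤ P := by
      have h2 : P ^ (1 / 16 : ℝ) * P ^ (1 / 8 : ℝ) ≤ P := by
        rw [← Real.rpow_add hP0]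
        conv_rhs => rw [← Real.rpow_one P]
        exact mono (by norm_num)
      nlinarith [Real.rpow_nonneg hP0.le (1 / 16 : ℝ)]
    rw [hP] at h1
    exact_mod_cast h1
  have hNp : 0 < N := by exact_mod_cast hNpos
  obtain ⟨T, hT0, hT1, hT2⟩ := exists_burgess_amplification hp16 c e r A B N hr0 hBp hAN hNp hce χ
    hχ1 hχ (K' * P ^ (κ / 4)) (by positivity) (fun m hm1 hm2 => (hK' m hm1).trans (by
      refine mul_le_mul_of_nonneg_left ?_ (by linarith)
      exact Real.rpow_le_rpow (by positivity) (by rw [hP]; exact_mod_cast hm2.le) (by positivity)))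
  have hsq : √P * √P = P := Real.mul_self_sqrt hP0.le
  have hM : (B : ℝ) ^ r * r ^ (2 * r) * P + B ^ (2 * r) * (14 * e * (r * e : ℕ) * √P) ≤
      B ^ (2 * r) * √P * K * e ^ 2 := by
    have h1 : (B : ℝ) ^ r * r ^ (2 * r) * P ≤ B ^ (2 * r) * √P * r ^ (2 * r) * e ^ 2 := by
      calc (B : ℝ) ^ r * r ^ (2 * r) * P = B ^ r * r ^ (2 * r) * √P * √P * 1 := by
            rw [mul_one, mul_assoc _ (√P), hsq]
        _ ≤ B ^ r * r ^ (2 * r) * √P * B ^ r * e ^ 2 := by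
            gcongr
            exact one_le_pow₀ e1
        _ = _ := by ring
    have h2 : (B : ℝ) ^ (2 * r) * (14 * e * (r * e : ℕ) * √P) =
      B ^ (2 * r) * √P * (14 * r) * e ^ 2 := by push_cast; ring
    rw [h2, hK]
    linarith
  have he2 : (e : ℝ) ^ 2 ≤ P ^ (2 * η) := by
    calc (e : ℝ) ^ 2 ≤ (P ^ η) ^ 2 := pow_le_pow_left₀ (by positivity) he 2
      _ = _ := by rw [← Real.rpow_natCast, ← Real.rpow_mul hP0.le]; congr 1; push_cast; ring
  have hkey : K' * P ^ (κ / 4) * (√P * K * e ^ 2) ≤ (A * N) * P ^ (-(κ / 2)) := by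
    have hANlow : P ^ (1 / 2 + 2 * κ - 2 * η - 1 / (2 * r)) / 4 ≤ A * N := by
      calc P ^ (1 / 2 + 2 * κ - 2 * η - 1 / (2 * r)) / 4 =
          (P ^ (1 / 4 + κ - 2 * η - 1 / (2 * r)) / 2) / 2 * P ^ (1 / 4 + κ) := by
            rw [div_div, div_mul_eq_mul_div, ← Real.rpow_add hP0]
            norm_num
            congr 1; ring
        _ ≤ x / 2 * N := by gcongr
        _ ≤ A * N := by gcongr
    calc K' * P ^ (κ / 4) * (√P * K * e ^ 2) ≤ K' * P ^ (κ / 4) * (√P * K * P ^ (2 * η)) := by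
          gcongr
      _ = (4 * K * K') * P ^ (κ / 4 + 1 / 2 + 2 * η) / 4 := by
          rw [Real.rpow_add hP0, Real.rpow_add hP0, Real.sqrt_eq_rpow]; ring
      _ ≤ P ^ (κ / 4) * P ^ (κ / 4 + 1 / 2 + 2 * η) / 4 := by gcongr
      _ ≤ P ^ (1 / 2 + 2 * κ - 2 * η - 1 / (2 * r)) / 4 * P ^ (-(κ / 2)) := by
          rw [div_mul_eq_mul_div, ← Real.rpow_add hP0, ← Real.rpow_add hP0]
          have := mono (x := κ / 4 + (κ / 4 + 1 / 2 + 2 * η))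
            (y := 1 / 2 + 2 * κ - 2 * η - 1 / (2 * r) + -(κ / 2)) (by linarith)
          linarith
      _ ≤ _ := by gcongr
  have hT : T ≤ A * B * N * P ^ (-(2 * η)) := by
    refine le_of_pow_le_pow_left₀ (n := 2 * r) (by lia) (by positivity) (hT2.trans ?_)
    have h1 : (P ^ (-(2 * η))) ^ (2 * r) = P ^ (-(κ / 2)) := by
      rw [← Real.rpow_natCast, ← Real.rpow_mul hP0.le]
      congr 1
      push_cast
      linarith
    calc _ ≤ (A * N : ℝ) ^ (2 * r - 1) * (K' * P ^ (κ / 4)) * (B ^ (2 * r) * √P * K * e ^ 2) := by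
          gcongr
      _ = (A * N : ℝ) ^ (2 * r - 1) * B ^ (2 * r) * (K' * P ^ (κ / 4) * (√P * K * e ^ 2)) := by ring
      _ ≤ (A * N : ℝ) ^ (2 * r - 1) * B ^ (2 * r) * ((A * N) * P ^ (-(κ / 2))) := by gcongr
      _ = (A * N : ℝ) ^ (2 * r) * B ^ (2 * r) * P ^ (-(κ / 2)) := by
          nth_rewrite 3 [show 2 * r = 2 * r - 1 + 1 by lia]
          rw [pow_succ]; ring
      _ = _ := by rw [← h1, ← mul_pow, ← mul_pow]; congr 1; ring
  have hABpos : (0 : ℝ) < A * B := by positivity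
  have h3 : A * B * ‖∑ n ∈ Finset.Icc 1 N, χ (n : ZMod p)‖ ≤ A * B * (3 * N * P ^ (-(2 * η))) := by
    refine hT1.trans ?_
    calc 2 * ((A : ℝ) * B) ^ 2 + T ≤ 2 * (A * B) * (A * B) + A * B * N * P ^ (-(2 * η)) := by
          rw [sq, ← mul_assoc]; gcongr
      _ ≤ 2 * (A * B) * (N * P ^ (-(2 * η))) + A * B * N * P ^ (-(2 * η)) := by gcongr
      _ = _ := by ring
  refine (le_of_mul_le_mul_left h3 hABpos).trans ?_
  have h4 : P ^ (-(2 * η)) * P ^ η = P ^ (-η) := by rw [← Real.rpow_add hP0]; congr 1; ring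
  rw [← h4]
  calc 3 * N * P ^ (-(2 * η)) = N * (P ^ (-(2 * η)) * 3) := by ring
    _ ≤ _ := by gcongr

lemma sum_moebius_divisors (a : ℕ) :
    ∑ d ∈ a.divisors, ArithmeticFunction.moebius d = if a = 1 then 1 else 0 := by
  rw [← ArithmeticFunction.coe_mul_zeta_apply, ArithmeticFunction.moebius_mul_coe_zeta,
    ArithmeticFunction.one_apply]

lemma sum_moebius_sq_dvd (X n : ℕ) (hn : 1 ≤ n) (hX : n ≤ X) :
    ∑ d ∈ (Finset.Icc 1 X).filter (fun d => d ^ 2 ∣ n), ArithmeticFunction.moebius d =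
      if Squarefree n then 1 else 0 := by
  obtain ⟨b, a, hb, ha, rfl, hbs⟩ := Nat.sq_mul_squarefree_of_pos hn
  have h1 : ∀ d : ℕ, d ^ 2 ∣ a ^ 2 * b ↔ d ∣ a := by
    intro d
    refine ⟨fun h => ?_, fun h => (pow_dvd_pow_of_dvd h 2).mul_right b⟩
    have hg : 0 < Nat.gcd d a := Nat.gcd_pos_of_pos_right _ ha
    obtain ⟨d', a', hda, h2, h3⟩ := Nat.exists_coprime d a
    generalize Nat.gcd d a = g at hg h2 h3
    subst h2 h3
    rw [mul_pow, mul_pow, mul_right_comm] at h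
    have h4 := Nat.dvd_of_mul_dvd_mul_right (by positivity) h
    have h5 : d' ^ 2 ∣ b := (Nat.Coprime.pow 2 2 hda).dvd_of_dvd_mul_left h4
    have h6 : d' = 1 := Nat.isUnit_iff.1 (hbs d' (by rwa [← sq]))
    rw [h6, one_mul]
    exact dvd_mul_left _ _
  have h2 : (Finset.Icc 1 X).filter (fun d => d ^ 2 ∣ a ^ 2 * b) = a.divisors := by
    ext d
    simp only [Finset.mem_filter, Finset.mem_Icc, h1, Nat.mem_divisors]
    constructor
    · rintro ⟨-, h⟩; exact ⟨h, by lia⟩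
    · rintro ⟨h, -⟩
      refine ⟨⟨Nat.pos_of_dvd_of_pos h ha, (Nat.le_of_dvd ha h).trans (le_trans ?_ hX)⟩, h⟩
      calc a ≤ a ^ 2 := Nat.le_self_pow (by norm_num) a
        _ ≤ a ^ 2 * b := Nat.le_mul_of_pos_right _ hb
  rw [h2, sum_moebius_divisors a]
  congr 1
  rw [eq_iff_iff]
  constructor
  · rintro rfl; simpa using hbs
  · intro h
    exact Nat.isUnit_iff.1 (h a ⟨b, by ring⟩)

lemma sum_Icc_filter_dvd {M : Type*} [AddCommMonoid M] (f : ℕ → M) (X k : ℕ) (hk : 0 < k) :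
    ∑ n ∈ (Finset.Icc 1 X).filter (fun n => k ∣ n), f n = ∑ m ∈ Finset.Icc 1 (X / k), f (k * m) := by
  symm
  refine Finset.sum_nbij (fun m => k * m) ?_ ?_ ?_ (fun _ _ => rfl)
  · intro m hm
    simp only [Finset.mem_Icc, Finset.mem_filter] at hm ⊢
    refine ⟨⟨Nat.mul_pos hk hm.1, ?_⟩, dvd_mul_right _ _⟩
    exact (Nat.mul_le_mul_left k hm.2).trans (Nat.mul_div_le X k)
  · intro a _ b _ h
    exact Nat.eq_of_mul_eq_mul_left hk h
  · intro n hn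
    simp only [Finset.coe_filter, Finset.mem_Icc, Set.mem_ofPred_eq] at hn
    obtain ⟨⟨h1, h2⟩, m, rfl⟩ := hn
    refine ⟨m, ?_, rfl⟩
    simp only [Finset.coe_Icc, Set.mem_Icc]
    refine ⟨Nat.pos_of_mul_pos_left (by lia : 0 < k * m), ?_⟩
    rw [Nat.le_div_iff_mul_le hk]; lia

lemma sum_squarefree_eq (f : ℕ → ℂ) (hf : ∀ a b, f (a * b) = f a * f b) (X : ℕ) :
    ∑ n ∈ (Finset.Icc 1 X).filter Squarefree, f n =
      ∑ d ∈ Finset.Icc 1 X, (ArithmeticFunction.moebius d : ℂ) * f (d ^ 2) *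
        ∑ m ∈ Finset.Icc 1 (X / d ^ 2), f m := by
  calc _ = ∑ n ∈ Finset.Icc 1 X, (if Squarefree n then (1 : ℂ) else 0) * f n := by
        rw [Finset.sum_filter]
        exact Finset.sum_congr rfl fun n _ => by split_ifs <;> simp
    _ = ∑ n ∈ Finset.Icc 1 X, ∑ d ∈ Finset.Icc 1 X,
          if d ^ 2 ∣ n then (ArithmeticFunction.moebius d : ℂ) * f n else 0 := by
        refine Finset.sum_congr rfl fun n hn => ?_
        rw [Finset.mem_Icc] at hn
        have := sum_moebius_sq_dvd X n hn.1 hn.2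
        have h2 : (if Squarefree n then (1 : ℂ) else 0) =
            ∑ d ∈ (Finset.Icc 1 X).filter (fun d => d ^ 2 ∣ n),
              (ArithmeticFunction.moebius d : ℂ) := by
          rw [← Int.cast_sum, this]; split_ifs <;> simp
        rw [h2, Finset.sum_mul, Finset.sum_filter]
    _ = _ := by
        rw [Finset.sum_comm]
        refine Finset.sum_congr rfl fun d hd => ?_
        rw [Finset.mem_Icc] at hd
        rw [← Finset.sum_filter, sum_Icc_filter_dvd _ _ _ (by have := hd.1; positivity),
          Finset.mul_sum]
        refine Finset.sum_congr rfl fun m _ => ?_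
        rw [hf, mul_assoc]

lemma norm_sum_squarefree_le (f : ℕ → ℂ) (hf : ∀ a b, f (a * b) = f a * f b)
    (hf1 : ∀ a, ‖f a‖ ≤ 1) (X : ℕ) :
    ‖∑ n ∈ (Finset.Icc 1 X).filter Squarefree, f n‖ ≤
      ∑ d ∈ Finset.Icc 1 X, ‖∑ m ∈ Finset.Icc 1 (X / d ^ 2), f m‖ := by
  rw [sum_squarefree_eq f hf]
  refine (norm_sum_le _ _).trans (Finset.sum_le_sum fun d _ => ?_)
  rw [norm_mul, norm_mul]
  have h1 : ‖(ArithmeticFunction.moebius d : ℂ)‖ ≤ 1 := by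
    rw [Complex.norm_intCast]
    exact_mod_cast ArithmeticFunction.abs_moebius_le_one
  refine mul_le_of_le_one_left (norm_nonneg _) ?_
  exact mul_le_one₀ h1 (norm_nonneg _) (hf1 _)

lemma card_squarefree_ge (X : ℕ) :
    (X : ℝ) / 12 ≤ (((Finset.Icc 1 X).filter Squarefree).card : ℝ) := by
  have h1 : (Finset.Icc 1 X).filter (fun n => ¬ Squarefree n) ⊆
      (Finset.Ioo 1 (X + 1)).biUnion fun d => (Finset.Icc 1 X).filter fun n => d ^ 2 ∣ n := by
    intro n hn
    rw [Finset.mem_filter, Finset.mem_Icc] at hn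
    obtain ⟨b, a, hb, ha, rfl, hbs⟩ := Nat.sq_mul_squarefree_of_pos hn.1.1
    simp only [Finset.mem_biUnion, Finset.mem_filter, Finset.mem_Icc, Finset.mem_Ioo]
    have h2 : a ≠ 1 := by rintro rfl; exact hn.2 (by simpa using hbs)
    refine ⟨a, ⟨by lia, Nat.lt_succ_of_le (le_trans ?_ hn.1.2)⟩, hn.1, dvd_mul_right _ _⟩
    calc a ≤ a ^ 2 := Nat.le_self_pow (by norm_num) a
      _ ≤ a ^ 2 * b := Nat.le_mul_of_pos_right _ hb
  have h2 : ((((Finset.Icc 1 X).filter (fun n => ¬ Squarefree n)).card : ℕ) : ℝ) ≤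
      ∑ d ∈ Finset.Ioo 1 (X + 1), X * ((d : ℝ) ^ 2)⁻¹ := by
    refine le_trans (Nat.cast_le.2 ((Finset.card_le_card h1).trans Finset.card_biUnion_le)) ?_
    push_cast
    refine Finset.sum_le_sum fun d hd => ?_
    rw [Finset.mem_Ioo] at hd
    have := sum_Icc_filter_dvd (fun _ => 1) X (d ^ 2) (by have := hd.1; positivity)
    rw [Finset.card_eq_sum_ones, this]
    simp only [Finset.sum_const, Nat.card_Icc, Nat.add_sub_cancel, smul_eq_mul, mul_one]
    refine Nat.cast_div_le.trans (le_of_eq ?_)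
    push_cast; rfl
  have h3 : ∑ d ∈ Finset.Ioo 1 (X + 1), ((d : ℝ) ^ 2)⁻¹ ≤ 1 / 4 + 2 / 3 := by
    have h4 : Finset.Ioo 1 (X + 1) ⊆ insert 2 (Finset.Ioo 2 (X + 1)) := by
      intro d hd
      simp only [Finset.mem_insert, Finset.mem_Ioo] at hd ⊢
      lia
    refine (Finset.sum_le_sum_of_subset_of_nonneg h4 fun _ _ _ => by positivity).trans ?_
    rw [Finset.sum_insert (by simp)]
    have := sum_Ioo_inv_sq_le (α := ℝ) 2 (X + 1)
    norm_num at this ⊢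
    linarith
  have h5 := Finset.card_filter_add_card_filter_not (s := Finset.Icc 1 X) Squarefree
  rw [Nat.card_Icc, Nat.add_sub_cancel] at h5
  have h6 : ((((Finset.Icc 1 X).filter Squarefree).card : ℕ) : ℝ) +
    (((Finset.Icc 1 X).filter (fun n => ¬ Squarefree n)).card : ℕ) = X := by exact_mod_cast h5
  rw [← Finset.mul_sum] at h2
  have h7 : (X : ℝ) * ∑ d ∈ Finset.Ioo 1 (X + 1), ((d : ℝ) ^ 2)⁻¹ ≤ X * (1 / 4 + 2 / 3) := by gcongr
  linarith

/-- Character sums over square-free integers. -/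
lemma exists_norm_sum_squarefree_mulChar_le {ε : ℝ} (hε : 0 < ε) (hε8 : ε ≤ 1 / 8) :
    ∃ η : ℝ, 0 < η ∧ η ≤ ε / 8 ∧ ∀ᶠ p : ℕ in Filter.atTop, ∀ [Fact p.Prime] (c e : ℕ),
      c * e = p - 1 → (e : ℝ) ≤ (p : ℝ) ^ η → ∀ χ : MulChar (ZMod p) ℂ, χ ≠ 1 → χ ^ e = 1 →
        ‖∑ n ∈ (Finset.Icc 1 ⌊(p : ℝ) ^ (1 / 4 + ε)⌋₊).filter Squarefree, χ (n : ZMod p)‖ ≤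
          4 * (p : ℝ) ^ (1 / 4 + ε - η) := by
  obtain ⟨η, hη0, hη64, h⟩ := exists_burgess_bound (κ := ε / 2) (by positivity) (by linarith)
  refine ⟨η, hη0, by linarith, ?_⟩
  filter_upwards [h, Filter.eventually_ge_atTop 1,
    eventually_le_natCast_rpow 3 (show 0 < ε / 4 by positivity)] with
    p hp hp1 hp2 _ c e hce he χ hχ1 hχ
  have hP1 : (1 : ℝ) ≤ p := by exact_mod_cast hp1
  have hP0 : (0 : ℝ) < p := by linarith
  have mono : ∀ {x y : ℝ}, x ≤ y → (p : ℝ) ^ x ≤ (p : ℝ) ^ y :=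
    fun h => Real.rpow_le_rpow_of_exponent_le hP1 h
  set Y := (p : ℝ) ^ (1 / 4 + ε) with hY
  have hY0 : 0 < Y := by positivity
  set X := ⌊Y⌋₊ with hX
  have hXY : (X : ℝ) ≤ Y := Nat.floor_le hY0.le
  have hYX : Y < X + 1 := Nat.lt_floor_add_one Y
  set y := (p : ℝ) ^ (ε / 8) with hy
  have hy1 : 1 ≤ y := Real.one_le_rpow hP1 (by positivity)
  refine (norm_sum_squarefree_le (fun n => χ (n : ZMod p)) (fun a b => by simp)
    (fun a => norm_mulChar_le_one _ _) X).trans ?_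
  have hdiv : ∀ d : ℕ, ((X / d ^ 2 : ℕ) : ℝ) ≤ Y * ((d : ℝ) ^ 2)⁻¹ := by
    intro d
    refine Nat.cast_div_le.trans ?_
    rw [div_eq_mul_inv]
    push_cast
    gcongr
  have hsmall : ∀ d : ℕ, 1 ≤ d → (d : ℝ) ≤ y →
      ‖∑ m ∈ Finset.Icc 1 (X / d ^ 2), χ (m : ZMod p)‖ ≤ Y * ((d : ℝ) ^ 2)⁻¹ * (p : ℝ) ^ (-η) := by
    intro d hd1 hdy
    have hd0 : (1 : ℝ) ≤ d := by exact_mod_cast hd1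
    have hdsq : (d : ℝ) ^ 2 ≤ p ^ (ε / 4) := by
      calc (d : ℝ) ^ 2 ≤ y ^ 2 := by gcongr
        _ = _ := by
          rw [hy, ← Real.rpow_natCast, ← Real.rpow_mul hP0.le]; congr 1; push_cast; ring
    refine (hp c e hce he χ hχ1 hχ _ ?_ ?_).trans (mul_le_mul_of_nonneg_right (hdiv d) (by positivity))
    · have h1 : X < d ^ 2 * (X / d ^ 2 + 1) := Nat.lt_mul_div_succ X (by positivity)
      have h2 : (X : ℝ) < d ^ 2 * ((X / d ^ 2 : ℕ) + 1) := by exact_mod_cast h1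
      set M : ℝ := ((X / d ^ 2 : ℕ) : ℝ) with hM
      have hM0 : 0 ≤ M := by positivity
      have h3 : Y < (p : ℝ) ^ (ε / 4) * (M + 2) := by
        have h4 : (1 : ℝ) ≤ d ^ 2 := one_le_pow₀ hd0
        nlinarith
      have h4 : Y = (p : ℝ) ^ (ε / 4) * (p : ℝ) ^ (1 / 4 + ε / 2 + ε / 4) := by
        rw [← Real.rpow_add hP0, hY]; congr 1; ring
      rw [h4] at h3
      have h5 := lt_of_mul_lt_mul_left h3 (by positivity)
      rw [Real.rpow_add hP0 (1 / 4 + ε / 2)] at h5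
      have h6 : 1 ≤ (p : ℝ) ^ (1 / 4 + ε / 2) := Real.one_le_rpow hP1 (by positivity)
      nlinarith
    · have h1 : ((X / d ^ 2 : ℕ) : ℝ) ≤ X := by exact_mod_cast Nat.div_le_self _ _
      exact h1.trans (hXY.trans (mono (by linarith)))
  have hlarge : ∀ d : ℕ, ‖∑ m ∈ Finset.Icc 1 (X / d ^ 2), χ (m : ZMod p)‖ ≤
      Y * ((d : ℝ) ^ 2)⁻¹ := by
    intro d
    refine le_trans ((norm_sum_le _ _).trans (Finset.sum_le_sum fun m _ =>
      norm_mulChar_le_one _ _)) ?_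
    simpa using hdiv d
  have hfl : (⌊y⌋₊ : ℝ) ≤ y := Nat.floor_le (by linarith)
  have hfl2 : y < ⌊y⌋₊ + 1 := Nat.lt_floor_add_one y
  have hsub : Finset.Icc 1 X ⊆ Finset.Ioo 0 (⌊y⌋₊ + 1) ∪ Finset.Ioo ⌊y⌋₊ (X + 1) := by
    intro d hd
    simp only [Finset.mem_union, Finset.mem_Icc, Finset.mem_Ioo] at hd ⊢
    lia
  have hs1 : ∑ d ∈ Finset.Ioo 0 (⌊y⌋₊ + 1), ‖∑ m ∈ Finset.Icc 1 (X / d ^ 2), χ (m : ZMod p)‖ ≤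
      2 * Y * (p : ℝ) ^ (-η) := by
    calc _ ≤ ∑ d ∈ Finset.Ioo 0 (⌊y⌋₊ + 1), Y * ((d : ℝ) ^ 2)⁻¹ * (p : ℝ) ^ (-η) := by
          refine Finset.sum_le_sum fun d hd => ?_
          rw [Finset.mem_Ioo] at hd
          refine hsmall d (by lia) (le_trans ?_ hfl)
          exact_mod_cast (by lia : d ≤ ⌊y⌋₊)
      _ = Y * (∑ d ∈ Finset.Ioo 0 (⌊y⌋₊ + 1), ((d : ℝ) ^ 2)⁻¹) * (p : ℝ) ^ (-η) := by
          rw [Finset.mul_sum, Finset.sum_mul]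
      _ ≤ Y * 2 * (p : ℝ) ^ (-η) := by
          have := sum_Ioo_inv_sq_le (α := ℝ) 0 (⌊y⌋₊ + 1)
          norm_num at this
          gcongr
      _ = _ := by ring
  have hs2 : ∑ d ∈ Finset.Ioo ⌊y⌋₊ (X + 1), ‖∑ m ∈ Finset.Icc 1 (X / d ^ 2), χ (m : ZMod p)‖ ≤
      2 * Y * (p : ℝ) ^ (-η) := by
    calc _ ≤ ∑ d ∈ Finset.Ioo ⌊y⌋₊ (X + 1), Y * ((d : ℝ) ^ 2)⁻¹ :=
          Finset.sum_le_sum fun d _ => hlarge d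
      _ ≤ Y * (2 / (⌊y⌋₊ + 1)) := by
          rw [← Finset.mul_sum]
          exact mul_le_mul_of_nonneg_left (sum_Ioo_inv_sq_le _ _) hY0.le
      _ ≤ Y * (2 / y) := by gcongr
      _ = 2 * Y * (p : ℝ) ^ (-(ε / 8)) := by rw [hy, Real.rpow_neg hP0.le]; ring
      _ ≤ _ := mul_le_mul_of_nonneg_left (mono (by linarith)) (by positivity)
  refine (Finset.sum_le_sum_of_subset_of_nonneg hsub fun _ _ _ => norm_nonneg _).trans ?_
  have h9 := Finset.sum_union_inter (s₁ := Finset.Ioo 0 (⌊y⌋₊ + 1)) (s₂ := Finset.Ioo ⌊y⌋₊ (X + 1))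
    (f := fun d => ‖∑ m ∈ Finset.Icc 1 (X / d ^ 2), χ (m : ZMod p)‖)
  have h10 : 0 ≤ ∑ d ∈ Finset.Ioo 0 (⌊y⌋₊ + 1) ∩ Finset.Ioo ⌊y⌋₊ (X + 1),
    ‖∑ m ∈ Finset.Icc 1 (X / d ^ 2), χ (m : ZMod p)‖ := Finset.sum_nonneg fun _ _ => norm_nonneg _
  rw [sub_eq_add_neg, Real.rpow_add hP0, ← hY]
  linarith

lemma exists_mulChar_pow_eq_one_iff {p : ℕ} [Fact p.Prime] (c e : ℕ) (hce : c * e = p - 1) :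
    ∃ χ : MulChar (ZMod p) ℂ, orderOf χ = e ∧ ∀ u : (ZMod p)ˣ, χ (u : ZMod p) = 1 ↔ u ^ c = 1 := by
  have hp2 := (Fact.out : p.Prime).two_le
  have he : e ≠ 0 := by rintro rfl; simp at hce; lia
  obtain ⟨χ, hχ⟩ := MulChar.exists_mulChar_orderOf (ZMod p) (R := ℂ) (n := e)
    (by rw [ZMod.card]; exact ⟨c, by rw [← hce, mul_comm]⟩) (Complex.isPrimitiveRoot_exp e he)
  refine ⟨χ, hχ, fun u => ⟨fun h => ?_, mulChar_eq_one_of_pow_eq_one c e hce χ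
    (by rw [← hχ]; exact pow_orderOf_eq_one χ) u⟩⟩
  obtain ⟨g, hg⟩ := IsCyclic.exists_generator (α := (ZMod p)ˣ)
  obtain ⟨k, rfl⟩ := (Submonoid.mem_powers_iff _ _).1 (mem_powers_iff_mem_zpowers.2 (hg u))
  have h1 : χ ^ k = 1 := by
    ext v
    obtain ⟨m, rfl⟩ := (Submonoid.mem_powers_iff _ _).1 (mem_powers_iff_mem_zpowers.2 (hg v))
    rw [MulChar.pow_apply_coe, MulChar.one_apply_coe, Units.val_pow_eq_pow_val, map_pow, ← pow_mul,
      mul_comm, pow_mul]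
    rw [Units.val_pow_eq_pow_val, map_pow] at h
    rw [h, one_pow]
  obtain ⟨l, rfl⟩ := hχ ▸ orderOf_dvd_of_pow_eq_one h1
  rw [← pow_mul, show e * l * c = (p - 1) * l by rw [← hce]; ring, pow_mul, ← ZMod.card_units p,
    pow_card_eq_one, one_pow]

/-- Equidistribution in cosets of the subgroup of `e`-th powers, from bounds on character sums. -/
lemma abs_card_filter_pow_eq_sub_le {p : ℕ} [Fact p.Prime] (c e : ℕ) (hce : c * e = p - 1)
    (s : Finset ℕ) (hs : ∀ n ∈ s, (n : ZMod p) ≠ 0) (E : ℝ) (hE0 : 0 ≤ E)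
    (hE : ∀ χ : MulChar (ZMod p) ℂ, χ ≠ 1 → χ ^ e = 1 → ‖∑ n ∈ s, χ (n : ZMod p)‖ ≤ E)
    (y : (ZMod p)ˣ) :
    |((s.filter fun n : ℕ => (n : ZMod p) ^ c = (y : ZMod p) ^ c).card : ℝ) - s.card / e| ≤ E := by
  classical
  have hp2 := (Fact.out : p.Prime).two_le
  have he : 0 < e := Nat.pos_of_ne_zero (by rintro rfl; simp at hce; lia)
  have heR : (0 : ℝ) < e := by exact_mod_cast he
  obtain ⟨χ, hχe, hχ⟩ := exists_mulChar_pow_eq_one_iff c e hce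
  have hχpow : χ ^ e = 1 := by rw [← hχe]; exact pow_orderOf_eq_one χ
  have h1 : ∀ n ∈ s, ∑ j ∈ Finset.range e, χ ((n : ZMod p) * (y⁻¹ : (ZMod p)ˣ)) ^ j =
      if (n : ZMod p) ^ c = (y : ZMod p) ^ c then (e : ℂ) else 0 := by
    intro n hn
    obtain ⟨v, hv⟩ : ∃ v : (ZMod p)ˣ, (v : ZMod p) = n := ⟨Units.mk0 _ (hs n hn), rfl⟩
    have h2 : χ ((v * y⁻¹ : (ZMod p)ˣ) : ZMod p) = 1 ↔ (v : ZMod p) ^ c = (y : ZMod p) ^ c := by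
      rw [hχ, mul_pow, inv_pow, mul_inv_eq_one, ← Units.val_inj]
      simp
    rw [← hv, ← Units.val_mul]
    split_ifs with h
    · rw [h2.2 h]; simp
    · have h3 : χ ((v * y⁻¹ : (ZMod p)ˣ) : ZMod p) ≠ 1 := fun h' => h (h2.1 h')
      have h4 : χ ((v * y⁻¹ : (ZMod p)ˣ) : ZMod p) ^ e = 1 := by
        rw [← MulChar.pow_apply_coe, hχpow, MulChar.one_apply_coe]
      rw [geom_sum_eq h3, h4, sub_self, zero_div]
  have h2 : (e : ℂ) * (s.filter fun n : ℕ => (n : ZMod p) ^ c = (y : ZMod p) ^ c).card =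
      ∑ j ∈ Finset.range e, χ ((y⁻¹ : (ZMod p)ˣ) : ZMod p) ^ j * ∑ n ∈ s, χ (n : ZMod p) ^ j := by
    calc _ = ∑ n ∈ s, if (n : ZMod p) ^ c = (y : ZMod p) ^ c then (e : ℂ) else 0 := by
          rw [← Finset.sum_filter, Finset.sum_const, nsmul_eq_mul, mul_comm]
      _ = ∑ n ∈ s, ∑ j ∈ Finset.range e, χ ((n : ZMod p) * (y⁻¹ : (ZMod p)ˣ)) ^ j :=
          Finset.sum_congr rfl fun n hn => (h1 n hn).symm
      _ = _ := by
          rw [Finset.sum_comm]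
          refine Finset.sum_congr rfl fun j _ => ?_
          rw [Finset.mul_sum]
          refine Finset.sum_congr rfl fun n _ => ?_
          rw [map_mul, mul_pow, mul_comm]
  have h3 : ‖(e : ℂ) * (s.filter fun n : ℕ => (n : ZMod p) ^ c = (y : ZMod p) ^ c).card - s.card‖ ≤
      e * E := by
    obtain ⟨k, rfl⟩ : ∃ k, e = k + 1 := ⟨e - 1, by lia⟩
    rw [h2, Finset.sum_range_succ']
    simp only [pow_zero, Finset.sum_const, nsmul_eq_mul, mul_one, one_mul, add_sub_cancel_right]
    calc _ ≤ ∑ j ∈ Finset.range k, E := by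
          refine (norm_sum_le _ _).trans (Finset.sum_le_sum fun j hj => ?_)
          rw [norm_mul, norm_pow, norm_mulChar_unit, one_pow, one_mul]
          have h4 : χ ^ (j + 1) ≠ 1 := by
            intro h
            have := Nat.le_of_dvd (by lia) (hχe ▸ orderOf_dvd_of_pow_eq_one h)
            rw [Finset.mem_range] at hj
            lia
          have h5 := hE (χ ^ (j + 1)) h4 (by rw [← pow_mul, mul_comm, pow_mul, hχpow, one_pow])
          refine le_trans (le_of_eq ?_) h5
          congr 1
          exact Finset.sum_congr rfl fun n _ => (MulChar.pow_apply' χ (by lia) _).symm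
      _ ≤ _ := by
          simp only [Finset.sum_const, Finset.card_range, nsmul_eq_mul]
          push_cast
          nlinarith
  have h4 : |(e : ℝ) * (s.filter fun n : ℕ => (n : ZMod p) ^ c = (y : ZMod p) ^ c).card - s.card| ≤
      e * E := by
    rw [← Real.norm_eq_abs]
    rw [← Complex.norm_real]
    push_cast
    exact h3
  rw [← mul_le_mul_iff_right₀ heR]
  refine le_trans (le_of_eq ?_) h4
  rw [← abs_of_pos heR, ← abs_mul, abs_of_pos heR]
  congr 1
  field_simp

lemma abs_card_orderOf_pow_eq_sub_le {p : ℕ} [Fact p.Prime] (c e D : ℕ) (hce : c * e = p - 1)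
    (hDe : D ∣ e) (s : Finset ℕ) (hs : ∀ n ∈ s, (n : ZMod p) ≠ 0) (E : ℝ) (hE0 : 0 ≤ E)
    (hE : ∀ χ : MulChar (ZMod p) ℂ, χ ≠ 1 → χ ^ e = 1 → ‖∑ n ∈ s, χ (n : ZMod p)‖ ≤ E) :
    |((s.filter fun n : ℕ => orderOf ((n : ZMod p) ^ c) = D).card : ℝ) -
      D.totient * (s.card / e)| ≤ D.totient * E := by
  classical
  have hp2 := (Fact.out : p.Prime).two_le
  have he : 0 < e := Nat.pos_of_ne_zero (by rintro rfl; simp at hce; lia)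
  set Z := Finset.univ.filter fun z : (ZMod p)ˣ => orderOf z = D with hZ
  have hZcard : Z.card = D.totient := by
    refine IsCyclic.card_orderOf_eq_totient ?_
    rw [ZMod.card_units, ← hce]
    exact hDe.mul_left c
  have h1 : (s.filter fun n : ℕ => orderOf ((n : ZMod p) ^ c) = D).card =
      ∑ z ∈ Z, (s.filter fun n : ℕ => (n : ZMod p) ^ c = (z : ZMod p)).card := by
    rw [← Finset.card_biUnion]
    · congr 1
      ext n
      simp only [Finset.mem_filter, Finset.mem_biUnion, hZ, Finset.mem_univ, true_and]
      constructor
      · rintro ⟨hn, h⟩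
        refine ⟨(Units.mk0 _ (hs n hn)) ^ c, ?_, hn, by simp⟩
        rw [← orderOf_units]
        simpa using h
      · rintro ⟨z, hz, hn, h⟩
        refine ⟨hn, ?_⟩
        rw [h, orderOf_units, hz]
    · intro x _ y _ hxy
      rw [Function.onFun, Finset.disjoint_filter]
      intro n _ h1 h2
      exact hxy (Units.ext (h1.symm.trans h2))
  rw [h1, ← hZcard]
  push_cast
  rw [← nsmul_eq_mul, ← nsmul_eq_mul, ← Finset.sum_const, ← Finset.sum_const,
    ← Finset.sum_sub_distrib]
  refine (Finset.abs_sum_le_sum_abs _ _).trans (Finset.sum_le_sum fun z hz => ?_)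
  have hz1 : z ^ e = 1 := by
    rw [hZ, Finset.mem_filter] at hz
    exact orderOf_dvd_iff_pow_eq_one.1 (hz.2 ▸ hDe)
  obtain ⟨y, rfl⟩ := exists_pow_of_pow_eq_one e c (by rw [mul_comm, hce]) z hz1
  rw [Units.val_pow_eq_pow_val]
  exact abs_card_filter_pow_eq_sub_le c e hce s hs E hE0 hE y

lemma orderOf_eq_of_pow_div_ne_one {p : ℕ} [Fact p.Prime] (x : ZMod p) (hx : x ≠ 0)
    (h : ∀ q : ℕ, q.Prime → q ∣ p - 1 → x ^ ((p - 1) / q) ≠ 1) : orderOf x = p - 1 :=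
  orderOf_eq_of_pow_and_pow_div_prime (Nat.sub_pos_of_lt (Fact.out : p.Prime).one_lt)
    (ZMod.pow_card_sub_one_eq_one hx) h

/-- The sieve for primitive roots. -/
lemma exists_primitiveRoot_of_sieve {p : ℕ} [Fact p.Prime] (D : ℕ) (hD : D ∣ p - 1)
    (Q R : Finset ℕ) (hQ : ∀ q ∈ Q, q.Prime ∧ q ∣ p - 1 ∧ ¬ q ∣ D)
    (hcover : ∀ q : ℕ, q.Prime → q ∣ p - 1 → q ∣ D ∨ q ∈ Q ∨ q ∈ R)
    (s : Finset ℕ) (hs : ∀ n ∈ s, (n : ZMod p) ≠ 0) (E F : ℝ) (hE0 : 0 ≤ E)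
    (hED : ∀ χ : MulChar (ZMod p) ℂ, χ ≠ 1 → χ ^ D = 1 → ‖∑ n ∈ s, χ (n : ZMod p)‖ ≤ E)
    (hEQ : ∀ q ∈ Q, ∀ χ : MulChar (ZMod p) ℂ, χ ≠ 1 → χ ^ (D * q) = 1 →
      ‖∑ n ∈ s, χ (n : ZMod p)‖ ≤ E)
    (hF : ∀ q ∈ R, ((s.filter fun n : ℕ => (n : ZMod p) ^ ((p - 1) / q) = 1).card : ℝ) ≤ F)
    (hF0 : 0 ≤ F)
    (hmain : ∑ q ∈ Q, (s.card / (D * q : ℕ) + E) + R.card * F < s.card / D - E) :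
    ∃ n ∈ s, orderOf (n : ZMod p) = p - 1 := by
  classical
  have hp1 : 0 < p - 1 := Nat.sub_pos_of_lt (Fact.out : p.Prime).one_lt
  have hD0 : 0 < D := Nat.pos_of_dvd_of_pos hD hp1
  by_contra! hno
  set G := s.filter fun n : ℕ => orderOf ((n : ZMod p) ^ ((p - 1) / D)) = D with hG
  have hGlow := (abs_le.1 (abs_card_orderOf_pow_eq_sub_le ((p - 1) / D) D D
    (Nat.div_mul_cancel hD) dvd_rfl s hs E hE0 hED)).1
  rw [← hG] at hGlow
  set BQ : ℕ → Finset ℕ := fun q =>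
    s.filter fun n : ℕ => orderOf ((n : ZMod p) ^ ((p - 1) / (D * q))) = D with hBQ
  set BR : ℕ → Finset ℕ := fun q =>
    s.filter fun n : ℕ => (n : ZMod p) ^ ((p - 1) / q) = 1 with hBR
  have hDq : ∀ q ∈ Q, D * q ∣ p - 1 := by
    intro q hq
    obtain ⟨h1, h2, h3⟩ := hQ q hq
    exact Nat.Coprime.mul_dvd_of_dvd_of_dvd ((Nat.Prime.coprime_iff_not_dvd h1).2 h3).symm hD h2
  have hsub : G ⊆ Q.biUnion BQ ∪ R.biUnion BR := by
    intro n hn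
    rw [hG, Finset.mem_filter] at hn
    obtain ⟨hns, hnD⟩ := hn
    have h1 : ∃ q : ℕ, q.Prime ∧ q ∣ p - 1 ∧ (n : ZMod p) ^ ((p - 1) / q) = 1 := by
      by_contra! h
      exact hno n hns (orderOf_eq_of_pow_div_ne_one _ (hs n hns) h)
    obtain ⟨q, hq, hqp, hqn⟩ := h1
    rw [Finset.mem_union, Finset.mem_biUnion, Finset.mem_biUnion]
    rcases hcover q hq hqp with h | h | h
    · exfalso
      obtain ⟨m, rfl⟩ := h
      have h2 : (p - 1) / q = (p - 1) / (q * m) * m := by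
        obtain ⟨k, hk⟩ := hD
        have hq0 := hq.pos
        rw [hk, Nat.mul_div_cancel_left _ hD0, mul_assoc, Nat.mul_div_cancel_left _ hq0, mul_comm]
      rw [h2, pow_mul] at hqn
      have h3 := orderOf_dvd_of_pow_eq_one hqn
      rw [hnD] at h3
      have hm0 : 0 < m := Nat.pos_of_mul_pos_left hD0
      have h4 := Nat.le_of_dvd hm0 h3
      have := hq.two_le
      nlinarith
    · left
      refine ⟨q, h, ?_⟩
      rw [hBQ, Finset.mem_filter]
      refine ⟨hns, ?_⟩
      obtain ⟨k, hk⟩ := hDq q h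
      have hq0 := hq.pos
      have e1 : (p - 1) / D = k * q := by
        rw [hk, mul_assoc, Nat.mul_div_cancel_left _ hD0, mul_comm]
      have e2 : (p - 1) / q = k * D := by
        rw [hk, mul_comm D, mul_assoc, Nat.mul_div_cancel_left _ hq0, mul_comm]
      have e3 : (p - 1) / (D * q) = k := by
        rw [hk, Nat.mul_div_cancel_left _ (Nat.mul_pos hD0 hq0)]
      rw [e1, pow_mul] at hnD
      rw [e2, pow_mul] at hqn
      rw [e3]
      refine Nat.dvd_antisymm (orderOf_dvd_of_pow_eq_one hqn) ?_
      conv_lhs => rw [← hnD]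
      exact orderOf_pow_dvd q
    · right
      exact ⟨q, h, by rw [hBR, Finset.mem_filter]; exact ⟨hns, hqn⟩⟩
  have hcard : (G.card : ℝ) ≤ ∑ q ∈ Q, ((BQ q).card : ℝ) + ∑ q ∈ R, ((BR q).card : ℝ) := by
    have := (Finset.card_le_card hsub).trans ((Finset.card_union_le _ _).trans
      (add_le_add Finset.card_biUnion_le Finset.card_biUnion_le))
    exact_mod_cast this
  have hsumQ : ∑ q ∈ Q, ((BQ q).card : ℝ) ≤ D.totient * ∑ q ∈ Q, (s.card / (D * q : ℕ) + E) := by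
    rw [Finset.mul_sum]
    refine Finset.sum_le_sum fun q hq => ?_
    have := (abs_le.1 (abs_card_orderOf_pow_eq_sub_le ((p - 1) / (D * q)) (D * q) D
      (Nat.div_mul_cancel (hDq q hq)) (dvd_mul_right _ _) s hs E hE0 (hEQ q hq))).2
    rw [mul_add]
    linarith
  have hsumR : ∑ q ∈ R, ((BR q).card : ℝ) ≤ R.card * F := by
    rw [← nsmul_eq_mul, ← Finset.sum_const]
    exact Finset.sum_le_sum hF
  have hφ : (1 : ℝ) ≤ D.totient := by exact_mod_cast Nat.totient_pos.2 hD0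
  have h5 : (D.totient : ℝ) * (∑ q ∈ Q, (s.card / (D * q : ℕ) + E) + R.card * F) <
      D.totient * (s.card / D - E) := mul_lt_mul_of_pos_left hmain (by linarith)
  have h6 : R.card * F ≤ D.totient * (R.card * F) := le_mul_of_one_le_left (by positivity) hφ
  linarith

lemma card_filter_natCast_mem_le {p : ℕ} [NeZero p] (H : Finset (ZMod p)) (M : ℕ) :
    ((Finset.Icc 1 M).filter fun m : ℕ => (m : ZMod p) ∈ H).card ≤ H.card * (M / p + 1) := by
  rw [← Finset.card_range (M / p + 1), ← Finset.card_product]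
  refine Finset.card_le_card_of_injOn (fun m => ((m : ZMod p), m / p)) ?_ ?_
  · intro m hm
    simp only [Finset.coe_filter, Finset.mem_Icc, Set.mem_ofPred_eq] at hm
    simp only [Finset.coe_product, Set.mem_prod, Finset.mem_coe, Finset.mem_range]
    exact ⟨hm.2, Nat.lt_succ_of_le (Nat.div_le_div_right hm.1.2)⟩
  · intro a _ b _ h
    simp only [Prod.mk.injEq] at h
    have h1 := (ZMod.natCast_eq_natCast_iff' _ _ _).1 h.1
    rw [← Nat.div_add_mod a p, ← Nat.div_add_mod b p, h1, h.2]

/-- The number of small integers in a subgroup, via products of four of them. -/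
lemma card_filter_pow_eq_one_pow_le {p : ℕ} [Fact p.Prime] (c q : ℕ) (hcq : c * q = p - 1)
    (X : ℕ) (D : ℕ) (hD : ∀ m : ℕ, 1 ≤ m → m ≤ X ^ 4 → m.divisors.card ≤ D) :
    ((Finset.Icc 1 X).filter fun n : ℕ => (n : ZMod p) ^ c = 1).card ^ 4 ≤
      D ^ 4 * (c * (X ^ 4 / p + 1)) := by
  classical
  have hc : c ≠ 0 := by
    have := (Fact.out : p.Prime).one_lt
    rintro rfl; lia
  set H : Finset (ZMod p) := (Finset.univ.filter fun u : (ZMod p)ˣ => u ^ c = 1).image Units.val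
    with hH
  have hHc : H.card ≤ c := Finset.card_image_le.trans (card_units_pow_eq_one c q hcq).le
  have hHmem : ∀ x : ZMod p, x ^ c = 1 → x ∈ H := by
    intro x hx
    rw [hH, Finset.mem_image]
    refine ⟨Units.mk0 x (by rintro rfl; simp [hc] at hx), ?_, rfl⟩
    rw [Finset.mem_filter]
    exact ⟨Finset.mem_univ _, Units.ext (by simpa using hx)⟩
  set S := (Finset.Icc 1 X).filter fun n : ℕ => (n : ZMod p) ^ c = 1 with hS
  have hcard : (Fintype.piFinset fun _ : Fin 4 => S).card = S.card ^ 4 := by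
    simp
  rw [← hcard]
  have himg : ((Fintype.piFinset fun _ : Fin 4 => S).image fun f => ∏ i, f i) ⊆
      (Finset.Icc 1 (X ^ 4)).filter fun m : ℕ => (m : ZMod p) ∈ H := by
    intro m hm
    obtain ⟨f, hf, rfl⟩ := Finset.mem_image.1 hm
    simp only [Fintype.mem_piFinset, hS, Finset.mem_filter, Finset.mem_Icc] at hf
    simp only [Finset.mem_filter, Finset.mem_Icc]
    refine ⟨⟨Nat.succ_le_of_lt (Finset.prod_pos fun i _ => (hf i).1.1), ?_⟩, hHmem _ ?_⟩
    · calc ∏ i, f i ≤ ∏ _i : Fin 4, X := Finset.prod_le_prod' fun i _ => (hf i).1.2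
        _ = X ^ 4 := by simp
    · push_cast
      rw [← Finset.prod_pow]
      exact Finset.prod_eq_one fun i _ => (hf i).2
  refine (Finset.card_le_mul_card_image (f := fun f : Fin 4 → ℕ => ∏ i, f i) _ (D ^ 4) ?_).trans ?_
  · intro m hm
    have hm' := Finset.mem_filter.1 (himg hm)
    rw [Finset.mem_Icc] at hm'
    have h1 : (Fintype.piFinset fun _ : Fin 4 => S).filter (fun f => ∏ i, f i = m) ⊆
        Fintype.piFinset fun _ : Fin 4 => m.divisors := by
      intro f hf
      rw [Finset.mem_filter] at hf
      rw [Fintype.mem_piFinset]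
      intro i
      rw [Nat.mem_divisors]
      exact ⟨hf.2 ▸ Finset.dvd_prod_of_mem f (Finset.mem_univ i), by lia⟩
    refine (Finset.card_le_card h1).trans ?_
    rw [Fintype.card_piFinset]
    simp only [Finset.prod_const, Finset.card_univ, Fintype.card_fin]
    exact Nat.pow_le_pow_left (hD m hm'.1.1 hm'.1.2) 4
  · refine Nat.mul_le_mul_left _ ((Finset.card_le_card himg).trans ?_)
    exact (card_filter_natCast_mem_le H _).trans (Nat.mul_le_mul_right _ hHc)

/-- Elements of small subgroups are rare among small integers. -/
lemma exists_card_filter_pow_eq_one_le {ε δ : ℝ} (hε : 0 < ε) (hε8 : ε ≤ 1 / 8) (hδ : 0 < δ) :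
    ∃ C : ℝ, 0 < C ∧ ∀ (p : ℕ) [Fact p.Prime] (q : ℕ), q ∣ p - 1 → (p : ℝ) ^ δ ≤ q →
      (((Finset.Icc 1 ⌊(p : ℝ) ^ (1 / 4 + ε)⌋₊).filter
        fun n : ℕ => (n : ZMod p) ^ ((p - 1) / q) = 1).card : ℝ) ≤
          C * (p : ℝ) ^ (1 / 4 + ε - δ / 8) := by
  obtain ⟨K, hK1, hK⟩ := exists_card_divisors_le (δ / 16) (by positivity)
  refine ⟨2 * K, by linarith, fun p _ q hq hpq => ?_⟩
  have hP1 : (1 : ℝ) ≤ p := by exact_mod_cast (Fact.out : p.Prime).one_lt.le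
  have hP0 : (0 : ℝ) < p := by linarith
  have mono : ∀ {x y : ℝ}, x ≤ y → (p : ℝ) ^ x ≤ (p : ℝ) ^ y :=
    fun h => Real.rpow_le_rpow_of_exponent_le hP1 h
  set X := ⌊(p : ℝ) ^ (1 / 4 + ε)⌋₊ with hX
  have hXY : (X : ℝ) ≤ (p : ℝ) ^ (1 / 4 + ε) := Nat.floor_le (by positivity)
  have hX4 : ((X ^ 4 : ℕ) : ℝ) ≤ (p : ℝ) ^ (1 + 4 * ε) := by
    push_cast
    calc (X : ℝ) ^ 4 ≤ ((p : ℝ) ^ (1 / 4 + ε)) ^ 4 := by gcongr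
      _ = _ := by rw [← Real.rpow_natCast, ← Real.rpow_mul hP0.le]; congr 1; push_cast; ring
  have hq0 : (0 : ℝ) < q := lt_of_lt_of_le (by positivity) hpq
  set D := ⌊K * (p : ℝ) ^ (δ / 8)⌋₊ with hD
  have hDle : (D : ℝ) ≤ K * (p : ℝ) ^ (δ / 8) := Nat.floor_le (by positivity)
  have hdiv : ∀ m : ℕ, 1 ≤ m → m ≤ X ^ 4 → m.divisors.card ≤ D := by
    intro m hm1 hm2
    refine Nat.le_floor ((hK m hm1).trans ?_)
    refine mul_le_mul_of_nonneg_left ?_ (by linarith)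
    have h1 : (m : ℝ) ≤ (p : ℝ) ^ (2 : ℝ) := by
      have h2 : (m : ℝ) ≤ ((X ^ 4 : ℕ) : ℝ) := by exact_mod_cast hm2
      exact (h2.trans hX4).trans (mono (by linarith))
    calc (m : ℝ) ^ (δ / 16) ≤ ((p : ℝ) ^ (2 : ℝ)) ^ (δ / 16) := by gcongr
      _ = _ := by rw [← Real.rpow_mul hP0.le]; congr 1; ring
  have hmain := card_filter_pow_eq_one_pow_le ((p - 1) / q) q (Nat.div_mul_cancel hq) X D hdiv
  have hc : (((p - 1) / q : ℕ) : ℝ) ≤ (p : ℝ) ^ (1 - δ) := by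
    refine Nat.cast_div_le.trans ?_
    rw [Real.rpow_sub hP0, Real.rpow_one]
    have : ((p - 1 : ℕ) : ℝ) ≤ p := by exact_mod_cast Nat.sub_le _ _
    gcongr
  have hM : ((X ^ 4 / p + 1 : ℕ) : ℝ) ≤ 2 * (p : ℝ) ^ (4 * ε) := by
    have h1 : ((X ^ 4 / p : ℕ) : ℝ) ≤ (p : ℝ) ^ (4 * ε) := by
      refine Nat.cast_div_le.trans ?_
      rw [div_le_iff₀ hP0]
      refine hX4.trans (le_of_eq ?_)
      rw [Real.rpow_add hP0, Real.rpow_one, mul_comm]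
    have h2 : 1 ≤ (p : ℝ) ^ (4 * ε) := Real.one_le_rpow hP1 (by positivity)
    push_cast
    linarith
  refine le_of_pow_le_pow_left₀ (n := 4) (by norm_num) (by positivity) ?_
  calc _ ≤ (D : ℝ) ^ 4 * (((p - 1) / q : ℕ) * (X ^ 4 / p + 1 : ℕ)) := by exact_mod_cast hmain
    _ ≤ (K * (p : ℝ) ^ (δ / 8)) ^ 4 * ((p : ℝ) ^ (1 - δ) * (2 * (p : ℝ) ^ (4 * ε))) := by gcongr
    _ = 2 * K ^ 4 * (p : ℝ) ^ (1 + 4 * ε - δ / 2) := by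
      have h1 : (p : ℝ) ^ (1 + 4 * ε - δ / 2) =
          ((p : ℝ) ^ (δ / 8)) ^ 4 * ((p : ℝ) ^ (1 - δ) * (p : ℝ) ^ (4 * ε)) := by
        rw [← Real.rpow_natCast, ← Real.rpow_mul hP0.le, ← Real.rpow_add hP0, ← Real.rpow_add hP0]
        congr 1; push_cast; ring
      rw [h1]; ring
    _ ≤ 16 * K ^ 4 * (p : ℝ) ^ (1 + 4 * ε - δ / 2) := by gcongr; norm_num
    _ = _ := by
      have h1 : (p : ℝ) ^ (1 + 4 * ε - δ / 2) = ((p : ℝ) ^ (1 / 4 + ε - δ / 8)) ^ 4 := by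
        rw [← Real.rpow_natCast, ← Real.rpow_mul hP0.le]
        congr 1; push_cast; ring
      rw [h1]; ring

lemma pow_card_le_of_subset_primeFactors {n z : ℕ} (hn : 0 < n) (Q : Finset ℕ)
    (hQ : Q ⊆ n.primeFactors) (hz : ∀ q ∈ Q, z ≤ q) : z ^ Q.card ≤ n := by
  calc z ^ Q.card ≤ ∏ q ∈ Q, q := Finset.pow_card_le_prod _ _ _ hz
    _ ≤ n := Nat.le_of_dvd hn (Finset.prod_primes_dvd n
      (fun q hq => (Nat.prime_of_mem_primeFactors (hQ hq)).prime)
      (fun q hq => Nat.dvd_of_mem_primeFactors (hQ hq)))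

set_option maxHeartbeats 1000000 in
lemma eventually_exists_squarefree_primitiveRoot {ε : ℝ} (hε : 0 < ε) (hε8 : ε ≤ 1 / 8) :
    ∀ᶠ p : ℕ in Filter.atTop, p.Prime → ∃ g : ℕ, 1 ≤ g ∧ Squarefree g ∧
      orderOf (g : ZMod p) = p - 1 ∧ (g : ℝ) ≤ (p : ℝ) ^ (1 / 4 + ε) := by
  obtain ⟨η, hη0, hηε, hchar⟩ := exists_norm_sum_squarefree_mulChar_le hε hε8
  obtain ⟨C, hC0, hC⟩ := exists_card_filter_pow_eq_one_le hε hε8 (show 0 < η / 2 by positivity)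
  set δ := η / 64 with hδ
  have hδ0 : 0 < δ := by positivity
  obtain ⟨K, hK1, hK⟩ := exists_card_divisors_le δ hδ0
  obtain ⟨Z, hZ⟩ := Filter.eventually_atTop.1
    ((Real.tendsto_log_atTop.comp tendsto_natCast_atTop_atTop).eventually_ge_atTop
      (8 / δ * Real.log 4) : ∀ᶠ z : ℕ in Filter.atTop, 8 / δ * Real.log 4 ≤ Real.log (z : ℝ))
  filter_upwards [hchar, Filter.eventually_ge_atTop 2,
    eventually_le_natCast_rpow (4 ^ (Z + 1)) hδ0,
    eventually_le_natCast_rpow 2 (show (0 : ℝ) < 1 / 4 by norm_num),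
    eventually_le_natCast_rpow (32 * (8 * K + K * C) + 1) (show 0 < η / 32 by positivity)] with
    p hchar hp2 hpZ hp4 hpmain hprime
  have : Fact p.Prime := ⟨hprime⟩
  have hP2 : (2 : ℝ) ≤ p := by exact_mod_cast hp2
  have hP1 : (1 : ℝ) ≤ p := by linarith
  have hP0 : (0 : ℝ) < p := by linarith
  have mono : ∀ {x y : ℝ}, x ≤ y → (p : ℝ) ^ x ≤ (p : ℝ) ^ y :=
    fun h => Real.rpow_le_rpow_of_exponent_le hP1 h
  have hp1 : 0 < p - 1 := by lia
  set Y := (p : ℝ) ^ (1 / 4 + ε) with hY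
  have hY0 : 0 < Y := by positivity
  have hY2 : 2 ≤ Y := hp4.trans (mono (by linarith))
  set X := ⌊Y⌋₊ with hX
  have hXY : (X : ℝ) ≤ Y := Nat.floor_le hY0.le
  have hYX : Y < X + 1 := Nat.lt_floor_add_one Y
  have hXp : X < p := by
    have h1 : Y < p := by
      rw [hY]
      conv_rhs => rw [← Real.rpow_one (p : ℝ)]
      exact Real.rpow_lt_rpow_of_exponent_lt (by linarith) (by linarith)
    exact_mod_cast hXY.trans_lt h1
  set s := (Finset.Icc 1 X).filter Squarefree with hs
  have hs0 : ∀ n ∈ s, (n : ZMod p) ≠ 0 := by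
    intro n hn h
    rw [hs, Finset.mem_filter, Finset.mem_Icc] at hn
    have := Nat.le_of_dvd hn.1.1 ((ZMod.natCast_eq_zero_iff _ _).1 h)
    lia
  have hscard : Y / 24 ≤ s.card := by
    have := card_squarefree_ge X
    rw [← hs] at this
    linarith
  set z := Nat.log 4 ⌊(p : ℝ) ^ δ⌋₊ with hz
  have hfl0 : ⌊(p : ℝ) ^ δ⌋₊ ≠ 0 :=
    (Nat.floor_pos.2 (Real.one_le_rpow hP1 hδ0.le)).ne'
  have hz1 : (4 : ℝ) ^ z ≤ (p : ℝ) ^ δ := by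
    have h1 : 4 ^ z ≤ ⌊(p : ℝ) ^ δ⌋₊ := Nat.pow_log_le_self 4 hfl0
    calc (4 : ℝ) ^ z ≤ (⌊(p : ℝ) ^ δ⌋₊ : ℝ) := by exact_mod_cast h1
      _ ≤ _ := Nat.floor_le (by positivity)
  have hz2 : (p : ℝ) ^ δ < 4 ^ (z + 1) := by
    have h1 : ⌊(p : ℝ) ^ δ⌋₊ < 4 ^ (z + 1) := Nat.lt_pow_succ_log_self (by norm_num) _
    have h2 : (⌊(p : ℝ) ^ δ⌋₊ : ℝ) + 1 ≤ 4 ^ (z + 1) := by exact_mod_cast h1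
    exact (Nat.lt_floor_add_one _).trans_le h2
  have hzZ : Z + 1 ≤ z := by
    rw [hz, Nat.le_log_iff_pow_le (by norm_num) hfl0]
    refine Nat.le_floor ?_
    push_cast
    exact hpZ
  have hzlog : 8 / δ * Real.log 4 ≤ Real.log z := hZ z (by lia)
  have hz0 : (1 : ℝ) ≤ z := by exact_mod_cast (by lia : 1 ≤ z)
  set D := ∏ q ∈ (p - 1).primeFactors.filter (fun q => q ≤ z), q with hD
  have hDdvd : D ∣ p - 1 := Finset.prod_primes_dvd _
    (fun q hq => (Nat.prime_of_mem_primeFactors (Finset.mem_filter.1 hq).1).prime)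
    (fun q hq => Nat.dvd_of_mem_primeFactors (Finset.mem_filter.1 hq).1)
  have hD0 : 0 < D := Nat.pos_of_dvd_of_pos hDdvd hp1
  have hDR0 : (0 : ℝ) < D := by exact_mod_cast hD0
  have hDz : D ≤ 4 ^ z := by
    refine le_trans ?_ (primorial_le_four_pow z)
    refine Finset.prod_le_prod_of_subset_of_one_le' ?_ ?_
    · intro q hq
      rw [Finset.mem_filter] at hq
      rw [Finset.mem_filter, Finset.mem_range]
      exact ⟨by lia, Nat.prime_of_mem_primeFactors hq.1⟩
    · intro q hq _
      exact (Finset.mem_filter.1 hq).2.one_lt.le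
  have hDp : (D : ℝ) ≤ (p : ℝ) ^ δ := le_trans (by exact_mod_cast hDz) hz1
  set Q := (p - 1).primeFactors.filter (fun q : ℕ => z < q ∧ (q : ℝ) < (p : ℝ) ^ (η / 2)) with hQ
  set R := (p - 1).primeFactors.filter (fun q : ℕ => (p : ℝ) ^ (η / 2) ≤ (q : ℝ)) with hR
  have hPcard : ((p - 1).primeFactors.card : ℝ) ≤ K * (p : ℝ) ^ δ := by
    calc ((p - 1).primeFactors.card : ℝ) ≤ (p - 1).divisors.card := by
          exact_mod_cast Finset.card_le_card fun q hq =>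
            Nat.mem_divisors.2 ⟨Nat.dvd_of_mem_primeFactors hq, hp1.ne'⟩
      _ ≤ K * ((p - 1 : ℕ) : ℝ) ^ δ := hK _ hp1
      _ ≤ K * (p : ℝ) ^ δ := by
          have : ((p - 1 : ℕ) : ℝ) ≤ p := by exact_mod_cast Nat.sub_le _ _
          gcongr
  have hQcard : (Q.card : ℝ) ≤ K * (p : ℝ) ^ δ :=
    le_trans (by exact_mod_cast Finset.card_le_card (Finset.filter_subset _ _)) hPcard
  have hRcard : (R.card : ℝ) ≤ K * (p : ℝ) ^ δ :=
    le_trans (by exact_mod_cast Finset.card_le_card (Finset.filter_subset _ _)) hPcard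
  have hQz : (Q.card : ℝ) ≤ z / 4 := by
    have h1 : z ^ Q.card ≤ p - 1 := pow_card_le_of_subset_primeFactors hp1 Q
      (Finset.filter_subset _ _) (fun q hq => (Finset.mem_filter.1 hq).2.1.le)
    have h2 : (z : ℝ) ^ Q.card ≤ p := by exact_mod_cast h1.trans (Nat.sub_le _ _)
    have h3 : Q.card * Real.log z ≤ Real.log p := by
      rw [← Real.log_pow]; exact Real.log_le_log (by positivity) h2
    have h4 : δ * Real.log p ≤ (z + 1) * Real.log 4 := by
      have := Real.log_le_log (by positivity) hz2.le
      rw [Real.log_rpow hP0, Real.log_pow] at this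
      exact_mod_cast this
    have h5 : 0 < Real.log 4 := Real.log_pos (by norm_num)
    have h6 : Q.card * (8 / δ * Real.log 4) ≤ Real.log p :=
      (mul_le_mul_of_nonneg_left hzlog (by positivity)).trans h3
    have h7 : δ * (Q.card * (8 / δ * Real.log 4)) = (8 * Q.card) * Real.log 4 := by field_simp
    have h8 := (mul_le_mul_of_nonneg_left h6 hδ0.le).trans h4
    rw [h7] at h8
    have h9 := le_of_mul_le_mul_right h8 h5
    linarith
  set E := 4 * (p : ℝ) ^ (1 / 4 + ε - η) with hE
  have hE0 : 0 ≤ E := by positivity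
  set F := C * (p : ℝ) ^ (1 / 4 + ε - η / 2 / 8) with hF
  have hF0 : 0 ≤ F := by positivity
  have hQD : ∀ q ∈ Q, ¬ q ∣ D := by
    intro q hq h
    rw [hQ, Finset.mem_filter] at hq
    have hqp := Nat.prime_of_mem_primeFactors hq.1
    obtain ⟨l, hl, hql⟩ := (hqp.prime.dvd_finsetProd_iff _).1 h
    rw [Finset.mem_filter] at hl
    have := (Nat.prime_dvd_prime_iff_eq hqp (Nat.prime_of_mem_primeFactors hl.1)).1 hql
    lia
  have hDq : ∀ q ∈ Q, D * q ∣ p - 1 := by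
    intro q hq
    have hq' := (Finset.mem_filter.1 hq).1
    exact Nat.Coprime.mul_dvd_of_dvd_of_dvd ((Nat.Prime.coprime_iff_not_dvd
      (Nat.prime_of_mem_primeFactors hq')).2 (hQD q hq)).symm hDdvd (Nat.dvd_of_mem_primeFactors hq')
  have hmain : ∑ q ∈ Q, (s.card / (D * q : ℕ) + E) + R.card * F < s.card / D - E := by
    have h1 : ∑ q ∈ Q, ((s.card : ℝ) / (D * q : ℕ) + E) ≤ s.card / D / 4 + K * (p : ℝ) ^ δ * E := by
      rw [Finset.sum_add_distrib]
      refine add_le_add ?_ ?_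
      · calc ∑ q ∈ Q, (s.card : ℝ) / (D * q : ℕ) ≤ ∑ q ∈ Q, (s.card : ℝ) / D / z := by
              refine Finset.sum_le_sum fun q hq => ?_
              have hzq : (z : ℝ) ≤ q := by exact_mod_cast (Finset.mem_filter.1 hq).2.1.le
              push_cast
              rw [div_div]
              gcongr
          _ = Q.card * (s.card / D / z) := by rw [Finset.sum_const, nsmul_eq_mul]
          _ ≤ z / 4 * (s.card / D / z) := by gcongr
          _ = _ := by field_simp
      · rw [Finset.sum_const, nsmul_eq_mul]; gcongr
    have h2 : R.card * F ≤ K * (p : ℝ) ^ δ * F := by gcongr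
    have h3 : Y * (p : ℝ) ^ (-δ) / 24 ≤ s.card / D := by
      rw [Real.rpow_neg hP0.le, ← div_eq_mul_inv, div_right_comm]
      gcongr
    have h4 : E ≤ 4 * (Y * (p : ℝ) ^ (-(η / 16))) := by
      rw [hE, hY, ← Real.rpow_add hP0]
      have := mono (show 1 / 4 + ε - η ≤ 1 / 4 + ε + -(η / 16) by linarith)
      linarith
    have h5 : F = C * (Y * (p : ℝ) ^ (-(η / 16))) := by
      rw [hF, hY, ← Real.rpow_add hP0]
      congr 2; ring
    have hpδ : 1 ≤ (p : ℝ) ^ δ := Real.one_le_rpow hP1 hδ0.le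
    have hKδ : 1 ≤ K * (p : ℝ) ^ δ := one_le_mul_of_one_le_of_one_le hK1 hpδ
    set W := Y * (p : ℝ) ^ (-(η / 16)) with hW
    have hW0 : 0 < W := by positivity
    have h6 : K * (p : ℝ) ^ δ * E + E + K * (p : ℝ) ^ δ * F ≤ (8 * K + K * C) * ((p : ℝ) ^ δ * W) := by
      have h7 : E ≤ K * (p : ℝ) ^ δ * E := le_mul_of_one_le_left hE0 hKδ
      have h8 : K * (p : ℝ) ^ δ * E ≤ K * (p : ℝ) ^ δ * (4 * W) := by gcongr
      rw [h5]
      linarith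
    have h7 : (p : ℝ) ^ (η / 32) * ((p : ℝ) ^ δ * W) = Y * (p : ℝ) ^ (-δ) := by
      rw [hW, hY, ← Real.rpow_add hP0, ← Real.rpow_add hP0, ← Real.rpow_add hP0,
        ← Real.rpow_add hP0]
      congr 1
      rw [hδ]; ring
    have hpW : 0 < (p : ℝ) ^ δ * W := by positivity
    have h8 := mul_le_mul_of_nonneg_right hpmain hpW.le
    rw [h7] at h8
    have h9 : (8 * K + K * C) * ((p : ℝ) ^ δ * W) < Y * (p : ℝ) ^ (-δ) / 32 := by linarith
    linarith
  obtain ⟨g, hg, hgo⟩ := exists_primitiveRoot_of_sieve D hDdvd Q R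
    (fun q hq => ⟨Nat.prime_of_mem_primeFactors (Finset.mem_filter.1 hq).1,
      Nat.dvd_of_mem_primeFactors (Finset.mem_filter.1 hq).1, hQD q hq⟩)
    (by
      intro q hq hqp
      have hmem : q ∈ (p - 1).primeFactors := Nat.mem_primeFactors.2 ⟨hq, hqp, hp1.ne'⟩
      by_cases h1 : q ≤ z
      · exact Or.inl (Finset.dvd_prod_of_mem _ (Finset.mem_filter.2 ⟨hmem, h1⟩))
      · by_cases h2 : (q : ℝ) < (p : ℝ) ^ (η / 2)
        · exact Or.inr (Or.inl (Finset.mem_filter.2 ⟨hmem, not_le.1 h1, h2⟩))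
        · exact Or.inr (Or.inr (Finset.mem_filter.2 ⟨hmem, not_lt.1 h2⟩)))
    s hs0 E F hE0
    (fun χ hχ1 hχ => hchar ((p - 1) / D) D (Nat.div_mul_cancel hDdvd)
      (hDp.trans (mono (by linarith))) χ hχ1 hχ)
    (fun q hq χ hχ1 hχ => hchar ((p - 1) / (D * q)) (D * q) (Nat.div_mul_cancel (hDq q hq))
      (by
        have hq2 := (Finset.mem_filter.1 hq).2.2
        push_cast
        calc (D : ℝ) * q ≤ (p : ℝ) ^ δ * (p : ℝ) ^ (η / 2) := by gcongr
          _ = (p : ℝ) ^ (δ + η / 2) := by rw [Real.rpow_add hP0]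
          _ ≤ _ := mono (by linarith)) χ hχ1 hχ)
    (by
      intro q hq
      rw [hR, Finset.mem_filter] at hq
      refine le_trans ?_ (hC p q (Nat.dvd_of_mem_primeFactors hq.1) hq.2)
      rw [Nat.cast_le]
      exact Finset.card_le_card (Finset.filter_subset_filter _ (Finset.filter_subset _ _)))
    hF0 hmain
  rw [hs, Finset.mem_filter, Finset.mem_Icc] at hg
  refine ⟨g, hg.1.1, hg.2, hgo, le_trans ?_ hXY⟩
  exact_mod_cast hg.1.2

lemma exists_prime_primitiveRoot (p : ℕ) [Fact p.Prime] :
    ∃ g : ℕ, g.Prime ∧ orderOf (g : ZMod p) = p - 1 := by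
  obtain ⟨u, hu⟩ := IsCyclic.exists_generator (α := (ZMod p)ˣ)
  obtain ⟨g, -, hg, hgu⟩ := Nat.forall_exists_prime_gt_and_eq_mod u.isUnit 0
  refine ⟨g, hg, ?_⟩
  rw [hgu, orderOf_units, orderOf_eq_card_of_forall_mem_zpowers hu, Nat.card_eq_fintype_card,
    ZMod.card_units]

/-- Proposition 1: for every `ε > 0`, every odd prime `p` has a square-free primitive root
that is at most `C(ε) p^(1/4+ε)`. -/
theorem least_squarefree_primitive_root_bound :
    ∀ ε : ℝ, 0 < ε → ∃ C : ℝ, 0 < C ∧ ∀ p : ℕ, p.Prime → Odd p →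
      ∃ g : ℕ, 1 ≤ g ∧ Squarefree g ∧ orderOf (g : ZMod p) = p - 1 ∧
        (g : ℝ) ≤ C * (p : ℝ) ^ ((1 : ℝ)/4 + ε) := by
  intro ε hε
  obtain ⟨P, hP⟩ := Filter.eventually_atTop.1 (eventually_exists_squarefree_primitiveRoot
    (ε := min ε (1 / 8)) (by positivity) (min_le_right _ _))
  have hex : ∀ p : ℕ, ∃ g : ℕ, p.Prime → g.Prime ∧ orderOf (g : ZMod p) = p - 1 := by
    intro p
    by_cases hp : p.Prime
    · have : Fact p.Prime := ⟨hp⟩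
      obtain ⟨g, hg⟩ := exists_prime_primitiveRoot p
      exact ⟨g, fun _ => hg⟩
    · exact ⟨0, fun h => absurd h hp⟩
  choose f hf using hex
  refine ⟨1 + ∑ p ∈ Finset.range P, (f p : ℝ), by positivity, fun p hp _ => ?_⟩
  have hp1 : (1 : ℝ) ≤ p := by exact_mod_cast hp.one_lt.le
  by_cases h : P ≤ p
  · obtain ⟨g, hg1, hg2, hg3, hg4⟩ := hP p h hp
    refine ⟨g, hg1, hg2, hg3, ?_⟩
    calc (g : ℝ) ≤ (p : ℝ) ^ (1 / 4 + min ε (1 / 8)) := hg4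
      _ ≤ (p : ℝ) ^ (1 / 4 + ε) :=
        Real.rpow_le_rpow_of_exponent_le hp1 (by linarith [min_le_left ε (1 / 8)])
      _ ≤ _ := le_mul_of_one_le_left (by positivity)
        (le_add_of_nonneg_right (Finset.sum_nonneg fun _ _ => Nat.cast_nonneg _))
  · refine ⟨f p, (hf p hp).1.one_lt.le, (hf p hp).1.prime.squarefree, (hf p hp).2, ?_⟩
    calc (f p : ℝ) ≤ ∑ p ∈ Finset.range P, (f p : ℝ) :=
          Finset.single_le_sum (f := fun p => (f p : ℝ)) (fun _ _ => Nat.cast_nonneg _)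
            (Finset.mem_range.2 (not_le.1 h))
      _ ≤ 1 + ∑ p ∈ Finset.range P, (f p : ℝ) := by linarith
      _ ≤ _ := le_mul_of_one_le_right (by positivity) (Real.one_le_rpow hp1 (by positivity))
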